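/- arXiv:2106.13380 — 9 statements merged into one kernel-verified Lean document; each statement's English description precedes it below -/
import Mathlib

section
/- Let n ≥ 3 and let u be a positive continuous function on the punctured unit ball B₁ \ {0} ⊂ ℝⁿ. Suppose there exists a sequence z_k ∈ B₁ \ {0} with z_k → 0 and |z_k|^{(n-2)/2} u(z_k) → ∞. Then there exist points x_k ∈ B₁ \ {0} with x_k → 0 and radii α_k ∈ (0, |x_k|/2) such that: u(x) ≤ 2^{(n-2)/2} u(x_k) for every x ∈ B_{α_k}(x_k), |x_k|^{(n-2)/2} u(x_k) → ∞, and u(x_k) α_k^{(n-2)/2} → ∞ as k → ∞. -/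
open Filter Metric

/-- Point selection on a closed ball: maximize `(r - dist x z) ^ p * u x`. -/
theorem exists_doubling_point_of_continuousOn_closedBall {X : Type*} [PseudoMetricSpace X]
    [ProperSpace X] {u : X → ℝ} {z : X} {r p : ℝ} (hr : 0 < r) (hp : 0 < p)
    (hu : ContinuousOn u (closedBall z r)) (hz : 0 < u z) :
    ∃ (x : X) (α : ℝ), 0 < α ∧ dist x z + 2 * α = r ∧
      (∀ y ∈ ball x α, u y ≤ (2 : ℝ) ^ p * u x) ∧ (r / 2) ^ p * u z ≤ u x * α ^ p := by
  have hcont : ContinuousOn (fun y => (r - dist y z) ^ p * u y) (closedBall z r) :=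
    ((by fun_prop : Continuous fun y => r - dist y z).continuousOn.rpow_const
      fun _ _ => Or.inr hp.le).mul hu
  obtain ⟨x, hx, hmax⟩ := (isCompact_closedBall z r).exists_isMaxOn
    ⟨z, mem_closedBall_self hr.le⟩ hcont
  have hxz : r ^ p * u z ≤ (r - dist x z) ^ p * u x := by
    simpa using hmax (mem_closedBall_self hr.le)
  have hpos : 0 < r ^ p * u z := by positivity
  have hlt : dist x z < r := by
    refine lt_of_le_of_ne hx fun h => ?_
    rw [h, sub_self, Real.zero_rpow hp.ne', zero_mul] at hxz
    exact hxz.not_gt hpos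
  obtain ⟨α, hα⟩ : ∃ α, r - dist x z = 2 * α := ⟨(r - dist x z) / 2, by ring⟩
  have hα0 : 0 < α := by linarith
  have hαp : 0 < α ^ p := by positivity
  have h2p : 0 < (2 : ℝ) ^ p := by positivity
  rw [hα, Real.mul_rpow zero_le_two hα0.le] at hxz
  refine ⟨x, α, hα0, by linarith, fun y hy => ?_, ?_⟩
  · have hyα : α ≤ r - dist y z := by
      linarith [dist_triangle y x z, mem_ball.mp hy]
    have hyr : (r - dist y z) ^ p * u y ≤ (2 ^ p * α ^ p) * u x := by
      have hy' : y ∈ closedBall z r := mem_closedBall.mpr (by linarith)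
      simpa only [Set.mem_ofPred_eq, hα, Real.mul_rpow zero_le_two hα0.le] using hmax hy'
    have hux : 0 < u x := pos_of_mul_pos_right (hpos.trans_le hxz) (by positivity)
    rcases le_or_gt (u y) 0 with h | h
    · exact h.trans (by positivity)
    · have : α ^ p * u y ≤ (r - dist y z) ^ p * u y := by gcongr
      refine le_of_mul_le_mul_left ?_ hαp
      linarith
  · rw [Real.div_rpow hr.le zero_le_two, div_mul_eq_mul_div, div_le_iff₀ h2p]
    linarith

/-- point-selection content of Lemma 2.2: if a positive continuous
function `u` on the punctured unit ball blows up faster than `|z|^{-(n-2)/2}` along a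
sequence `z_k → 0`, then one can select local-maximum-type points `x_k → 0` and radii
`α_k ∈ (0, |x_k|/2)` with `u ≤ 2^{(n-2)/2} u(x_k)` on `B_{α_k}(x_k)`,
`|x_k|^{(n-2)/2} u(x_k) → ∞` and `u(x_k) α_k^{(n-2)/2} → ∞`. -/
theorem blow_up_point_selection
    (n : ℕ) (hn : 3 ≤ n)
    (u : EuclideanSpace ℝ (Fin n) → ℝ)
    (hu_cont : ContinuousOn u (ball (0 : EuclideanSpace ℝ (Fin n)) 1 \ {0}))
    (hu_pos : ∀ x ∈ ball (0 : EuclideanSpace ℝ (Fin n)) 1 \ {0}, 0 < u x)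
    (z : ℕ → EuclideanSpace ℝ (Fin n))
    (hz_mem : ∀ k, z k ∈ ball (0 : EuclideanSpace ℝ (Fin n)) 1 \ {0})
    (hz_lim : Tendsto z atTop (nhds 0))
    (hz_blow : Tendsto (fun k => ‖z k‖ ^ (((n : ℝ) - 2) / 2) * u (z k)) atTop atTop) :
    ∃ (x : ℕ → EuclideanSpace ℝ (Fin n)) (α : ℕ → ℝ),
      (∀ k, x k ∈ ball (0 : EuclideanSpace ℝ (Fin n)) 1 \ {0}) ∧
      Tendsto x atTop (nhds 0) ∧
      (∀ k, 0 < α k ∧ α k < ‖x k‖ / 2) ∧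
      (∀ k, ball (x k) (α k) ⊆ ball (0 : EuclideanSpace ℝ (Fin n)) 1 \ {0}) ∧
      (∀ k, ∀ y ∈ ball (x k) (α k), u y ≤ (2 : ℝ) ^ (((n : ℝ) - 2) / 2) * u (x k)) ∧
      Tendsto (fun k => ‖x k‖ ^ (((n : ℝ) - 2) / 2) * u (x k)) atTop atTop ∧
      Tendsto (fun k => u (x k) * α k ^ (((n : ℝ) - 2) / 2)) atTop atTop := by
  have hp : 0 < ((n : ℝ) - 2) / 2 := by
    have : (3 : ℝ) ≤ n := by exact_mod_cast hn
    linarith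
  generalize ((n : ℝ) - 2) / 2 = p at *
  set r : ℕ → ℝ := fun k => min ‖z k‖ (1 - ‖z k‖) / 4 with hr_def
  have hz0 k : 0 < ‖z k‖ := norm_pos_iff.mpr (hz_mem k).2
  have hz1 k : ‖z k‖ < 1 := mem_ball_zero_iff.mp (hz_mem k).1
  have hr0 k : 0 < r k := div_pos (lt_min (hz0 k) (sub_pos.mpr (hz1 k))) four_pos
  have hrz k : r k ≤ ‖z k‖ / 4 := div_le_div_of_nonneg_right (min_le_left _ _) four_pos.le
  have hrz' k : r k ≤ (1 - ‖z k‖) / 4 :=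
    div_le_div_of_nonneg_right (min_le_right _ _) four_pos.le
  have hsub k : closedBall (z k) (r k) ⊆ ball 0 1 \ {0} := by
    intro y hy
    have hy' : ‖y - z k‖ ≤ r k := mem_closedBall_iff_norm.mp hy
    have h1 := norm_sub_norm_le y (z k)
    have h2 := norm_sub_norm_le (z k) y
    rw [norm_sub_rev] at h2
    refine ⟨mem_ball_zero_iff.mpr ?_, norm_pos_iff.mp ?_⟩ <;>
      linarith [hz0 k, hz1 k, hrz k, hrz' k]
  choose x α hα0 hxα hle hlow using fun k =>
    exists_doubling_point_of_continuousOn_closedBall (hr0 k) hp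
      (hu_cont.mono (hsub k)) (hu_pos _ (hz_mem k))
  have hball k : ball (x k) (α k) ⊆ closedBall (z k) (r k) :=
    ball_subset_closedBall.trans
      (closedBall_subset_closedBall' (by linarith [hxα k, hα0 k]))
  have hx_mem k : x k ∈ ball (0 : EuclideanSpace ℝ (Fin n)) 1 \ {0} :=
    hsub k (hball k (mem_ball_self (hα0 k)))
  have hdist k : dist (x k) (z k) ≤ ‖z k‖ / 4 := by linarith [hxα k, hα0 k, hrz k]
  have hαx k : α k < ‖x k‖ / 2 := by
    have h := norm_sub_norm_le (z k) (x k)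
    rw [norm_sub_rev, ← dist_eq_norm] at h
    linarith [hdist k, hxα k, hrz k, hz0 k, dist_nonneg (x := x k) (y := z k)]
  have hznorm : Tendsto (fun k => ‖z k‖) atTop (nhds 0) :=
    tendsto_zero_iff_norm_tendsto_zero.mp hz_lim
  have hx_lim : Tendsto x atTop (nhds 0) := by
    have hxz : Tendsto (fun k => dist (z k) (x k)) atTop (nhds 0) :=
      squeeze_zero (fun _ => dist_nonneg) (fun k => dist_comm (x k) (z k) ▸ hdist k)
        (by simpa using hznorm.div_const 4)
    exact hz_lim.congr_dist hxz
  have hα_blow : Tendsto (fun k => u (x k) * α k ^ p) atTop atTop := by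
    refine tendsto_atTop_mono' atTop ?_
      (hz_blow.const_mul_atTop (show (0 : ℝ) < (1 / 8) ^ p by positivity))
    filter_upwards [hznorm.eventually_le_const (show (0 : ℝ) < 1 / 2 by norm_num)] with k hk
    have hrk : r k / 2 = 1 / 8 * ‖z k‖ := by
      simp only [hr_def]
      rw [min_eq_left (by linarith)]
      ring
    have h := hlow k
    rwa [hrk, Real.mul_rpow (by norm_num) (norm_nonneg _), mul_assoc] at h
  refine ⟨x, α, hx_mem, hx_lim, fun k => ⟨hα0 k, hαx k⟩, fun k => (hball k).trans (hsub k),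
    hle, tendsto_atTop_mono (fun k => ?_) hα_blow, hα_blow⟩
  have hux := hu_pos _ (hx_mem k)
  have hαk : α k ≤ ‖x k‖ := by linarith [hαx k, hα0 k]
  rw [mul_comm]
  gcongr
  exact (hα0 k).le
end

section
/- Let n ≥ 3, λ > 0, Ω ⊆ ℝⁿ an open set, and let u be a twice continuously differentiable function on Ω. Let Ω* = {y ∈ ℝⁿ \ {0} : λ²y/|y|² ∈ Ω} and define the Kelvin transform u^λ(y) = (λ/|y|)^{n-2} u(λ²y/|y|²) for y ∈ Ω*. Then for every y ∈ Ω*, Δ(u^λ)(y) = (λ/|y|)^{n+2} (Δu)(λ²y/|y|²), where Δ denotes the Euclidean Laplacian. -/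
/-- The Euclidean Laplacian of `u : ℝⁿ → ℝ`, as the trace of the Hessian. -/
noncomputable def lap {n : ℕ} (u : EuclideanSpace ℝ (Fin n) → ℝ)
    (x : EuclideanSpace ℝ (Fin n)) : ℝ :=
  ∑ i, iteratedFDeriv ℝ 2 u x ![EuclideanSpace.single i (1 : ℝ), EuclideanSpace.single i 1]

/-- The Kelvin transform `u^λ(y) = (λ/|y|)^{n-2} u(λ²y/|y|²)` with respect to the sphere
`∂B_λ`. -/
noncomputable def kelvin {n : ℕ} (lam : ℝ) (u : EuclideanSpace ℝ (Fin n) → ℝ)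
    (y : EuclideanSpace ℝ (Fin n)) : ℝ :=
  (lam / ‖y‖) ^ ((n : ℝ) - 2) * u ((lam ^ 2 / ‖y‖ ^ 2) • y)

open Filter Topology

section LineDerivatives

variable {E F : Type*} [NormedAddCommGroup E] [NormedSpace ℝ E]
  [NormedAddCommGroup F] [NormedSpace ℝ F]

theorem hasDerivAt_add_smul (y e : E) (t : ℝ) : HasDerivAt (fun t : ℝ => y + t • e) e t := by
  simpa using ((hasDerivAt_id t).smul_const e).const_add y

theorem tendsto_add_smul_zero (y e : E) : Tendsto (fun t : ℝ => y + t • e) (𝓝 0) (𝓝 y) := by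
  simpa using (hasDerivAt_add_smul y e 0).continuousAt.tendsto

/-- The second derivative in a direction is the second derivative along the line. -/
theorem iteratedFDeriv_two_eq_of_hasDerivAt_line {f : E → F} {y e : E} (hf : ContDiffAt ℝ 2 f y)
    {g : ℝ → F} {d : F} (hg : ∀ᶠ t in 𝓝 (0 : ℝ), HasDerivAt (fun t : ℝ => f (y + t • e)) (g t) t)
    (hd : HasDerivAt g d 0) : iteratedFDeriv ℝ 2 f y ![e, e] = d := by
  rw [iteratedFDeriv_two_apply]
  have h1 : ∀ᶠ x in 𝓝 y, DifferentiableAt ℝ f x :=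
    (hf.eventually (by simp)).mono fun x hx => hx.differentiableAt (by simp)
  have hg' : g =ᶠ[𝓝 0] fun t : ℝ => fderiv ℝ f (y + t • e) e := by
    filter_upwards [hg, (tendsto_add_smul_zero y e).eventually h1] with t ht h
    exact ht.unique (h.hasFDerivAt.comp_hasDerivAt t (hasDerivAt_add_smul y e t))
  have h2 : DifferentiableAt ℝ (fderiv ℝ f) y :=
    (hf.fderiv_right (m := 1) (by norm_num)).differentiableAt (by simp)
  have h3 : HasDerivAt (fun t : ℝ => fderiv ℝ f (y + t • e)) (fderiv ℝ (fderiv ℝ f) y e) 0 :=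
    HasFDerivAt.comp_hasDerivAt_of_eq 0 h2.hasFDerivAt (hasDerivAt_add_smul y e 0) (by simp)
  have h4 : HasDerivAt (fun t : ℝ => fderiv ℝ f (y + t • e) e)
      (fderiv ℝ (fderiv ℝ f) y e e) 0 := by
    simpa using h3.clm_apply (hasDerivAt_const 0 e)
  exact (h4.congr_of_eventuallyEq hg').unique hd

end LineDerivatives

/-- Leibniz and chain rule to second order, for `c • (u ∘ w)` along a curve `w`. -/
theorem hasDerivAt_deriv_mul_comp {E : Type*} [NormedAddCommGroup E] [NormedSpace ℝ E]
    {u : E → ℝ} {c c₁ : ℝ → ℝ} {w w₁ : ℝ → E} {c₂ t : ℝ} {w₂ : E}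
    (hu : ContDiffAt ℝ 2 u (w t)) (hc : HasDerivAt c (c₁ t) t) (hc₁ : HasDerivAt c₁ c₂ t)
    (hw : HasDerivAt w (w₁ t) t) (hw₁ : HasDerivAt w₁ w₂ t) :
    HasDerivAt (fun t => c₁ t * u (w t) + c t * fderiv ℝ u (w t) (w₁ t))
      (c₂ * u (w t) + 2 * c₁ t * fderiv ℝ u (w t) (w₁ t)
        + c t * (fderiv ℝ (fderiv ℝ u) (w t) (w₁ t) (w₁ t) + fderiv ℝ u (w t) w₂)) t := by
  have h1 := (hu.differentiableAt (by simp)).hasFDerivAt.comp_hasDerivAt t hw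
  have h2 : DifferentiableAt ℝ (fderiv ℝ u) (w t) :=
    (hu.fderiv_right (m := 1) (by norm_num)).differentiableAt (by simp)
  have h3 := (h2.hasFDerivAt.comp_hasDerivAt t hw).clm_apply hw₁
  refine ((hc₁.mul h1).add (hc.mul h3)).congr_deriv ?_
  simp only [Function.comp_apply]
  ring

section Inner

variable {E : Type*} [NormedAddCommGroup E] [InnerProductSpace ℝ E]

theorem hasDerivAt_norm_sq_line (y e : E) (t : ℝ) :
    HasDerivAt (fun t : ℝ => ‖y + t • e‖ ^ 2) (2 * inner ℝ (y + t • e) e) t :=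
  (hasDerivAt_add_smul y e t).norm_sq

theorem hasDerivAt_inner_line {e : E} (he : ‖e‖ = 1) (y : E) (t : ℝ) :
    HasDerivAt (fun t : ℝ => inner ℝ (y + t • e) e) 1 t := by
  simpa [he] using (hasDerivAt_add_smul y e t).inner ℝ (hasDerivAt_const t e)

theorem hasDerivAt_norm_sq_rpow_line {y e : E} {t : ℝ} (h : y + t • e ≠ 0) (a : ℝ) :
    HasDerivAt (fun t : ℝ => (‖y + t • e‖ ^ 2) ^ a)
      (2 * a * inner ℝ (y + t • e) e * (‖y + t • e‖ ^ 2) ^ (a - 1)) t := by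
  refine ((hasDerivAt_norm_sq_line y e t).rpow_const (p := a)
    (Or.inl (by positivity))).congr_deriv ?_
  ring

theorem hasDerivAt_inversion_line {y e : E} {t : ℝ} (h : y + t • e ≠ 0) :
    HasDerivAt (fun t : ℝ => (‖y + t • e‖ ^ 2)⁻¹ • (y + t • e))
      ((‖y + t • e‖ ^ 2)⁻¹ • e
        + (-(2 * inner ℝ (y + t • e) e) / (‖y + t • e‖ ^ 2) ^ 2) • (y + t • e)) t :=
  ((hasDerivAt_norm_sq_line y e t).inv (by positivity)).smul (hasDerivAt_add_smul y e t)

theorem hasDerivAt_deriv_inversion_line {y e : E} (he : ‖e‖ = 1) (h : y ≠ 0) :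
    HasDerivAt (fun t : ℝ => (‖y + t • e‖ ^ 2)⁻¹ • e
        + (-(2 * inner ℝ (y + t • e) e) / (‖y + t • e‖ ^ 2) ^ 2) • (y + t • e))
      ((-(4 * inner ℝ y e) / (‖y‖ ^ 2) ^ 2) • e
        + (8 * inner ℝ y e ^ 2 / (‖y‖ ^ 2) ^ 3 - 2 / (‖y‖ ^ 2) ^ 2) • y) 0 := by
  have hq := hasDerivAt_norm_sq_line y e 0
  have hy : ‖y + (0 : ℝ) • e‖ ^ 2 ≠ 0 := by simpa using h
  have hr : ‖y‖ ≠ 0 := by simpa using h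
  have h1 := ((hasDerivAt_inner_line he y 0).const_mul 2).neg.div (hq.pow 2) (pow_ne_zero 2 hy)
  refine (((hq.inv hy).smul_const e).add (h1.smul (hasDerivAt_add_smul y e 0))).congr_deriv ?_
  simp only [Pi.neg_apply, Pi.pow_apply, Pi.div_apply, zero_smul, add_zero]
  match_scalars
  · field_simp
    ring
  · field_simp
    ring

theorem contDiffAt_smul_inversion {y : E} (hy : y ≠ 0) (s : ℝ) :
    ContDiffAt ℝ 2 (fun z : E => s • (‖z‖ ^ 2)⁻¹ • z) y :=
  contDiffAt_const.smul
    (((contDiff_norm_sq ℝ).contDiffAt.inv (by positivity)).smul contDiffAt_id)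

theorem contDiffAt_norm_rpow_mul_comp_inversion {u : E → ℝ} {y : E} (hy : y ≠ 0) (a : ℝ) {s : ℝ}
    (hu : ContDiffAt ℝ 2 u (s • (‖y‖ ^ 2)⁻¹ • y)) :
    ContDiffAt ℝ 2 (fun z => (‖z‖ ^ 2) ^ a * u (s • (‖z‖ ^ 2)⁻¹ • z)) y :=
  ((contDiff_norm_sq ℝ).contDiffAt.rpow_const_of_ne (by positivity)).mul
    (hu.comp y (contDiffAt_smul_inversion hy s))

/-- Second directional derivative of `|y|^{2a} u(s y/|y|²)`. -/
theorem iteratedFDeriv_two_norm_rpow_mul_comp_inversion {u : E → ℝ} {y e : E} (he : ‖e‖ = 1)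
    (hy : y ≠ 0) (a s : ℝ) (hu : ContDiffAt ℝ 2 u (s • (‖y‖ ^ 2)⁻¹ • y)) :
    iteratedFDeriv ℝ 2 (fun z => (‖z‖ ^ 2) ^ a * u (s • (‖z‖ ^ 2)⁻¹ • z)) y ![e, e] =
      (2 * a * (‖y‖ ^ 2) ^ (a - 1)
          + 4 * a * (a - 1) * inner ℝ y e ^ 2 * (‖y‖ ^ 2) ^ (a - 2)) * u (s • (‖y‖ ^ 2)⁻¹ • y)
        + 2 * (2 * a * inner ℝ y e * (‖y‖ ^ 2) ^ (a - 1)) * fderiv ℝ u (s • (‖y‖ ^ 2)⁻¹ • y)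
          (s • ((‖y‖ ^ 2)⁻¹ • e + (-(2 * inner ℝ y e) / (‖y‖ ^ 2) ^ 2) • y))
        + (‖y‖ ^ 2) ^ a * (fderiv ℝ (fderiv ℝ u) (s • (‖y‖ ^ 2)⁻¹ • y)
            (s • ((‖y‖ ^ 2)⁻¹ • e + (-(2 * inner ℝ y e) / (‖y‖ ^ 2) ^ 2) • y))
            (s • ((‖y‖ ^ 2)⁻¹ • e + (-(2 * inner ℝ y e) / (‖y‖ ^ 2) ^ 2) • y))
          + fderiv ℝ u (s • (‖y‖ ^ 2)⁻¹ • y)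
            (s • ((-(4 * inner ℝ y e) / (‖y‖ ^ 2) ^ 2) • e
              + (8 * inner ℝ y e ^ 2 / (‖y‖ ^ 2) ^ 3 - 2 / (‖y‖ ^ 2) ^ 2) • y))) := by
  have hΦ := contDiffAt_smul_inversion hy s
  have hF := contDiffAt_norm_rpow_mul_comp_inversion hy a hu
  have hev : ∀ᶠ z in 𝓝 y, z ≠ 0 ∧ ContDiffAt ℝ 2 u (s • (‖z‖ ^ 2)⁻¹ • z) :=
    (isOpen_ne.eventually_mem hy).and
      (hΦ.continuousAt.eventually (hu.eventually (by simp)))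
  have y0 : y + (0 : ℝ) • e ≠ 0 := by simpa using hy
  have hc₁ := ((hasDerivAt_inner_line he y 0).const_mul (2 * a)).mul
    (hasDerivAt_norm_sq_rpow_line y0 (a - 1))
  have key := hasDerivAt_deriv_mul_comp (u := u) (by simpa using hu)
    (hasDerivAt_norm_sq_rpow_line y0 a) hc₁
    ((hasDerivAt_inversion_line y0).const_smul s)
    ((hasDerivAt_deriv_inversion_line he hy).const_smul s)
  refine iteratedFDeriv_two_eq_of_hasDerivAt_line hF ?_ (key.congr_deriv ?_)
  · filter_upwards [(tendsto_add_smul_zero y e).eventually hev] with t ht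
    exact (hasDerivAt_norm_sq_rpow_line ht.1 a).mul
      ((ht.2.differentiableAt (by simp)).hasFDerivAt.comp_hasDerivAt t
        ((hasDerivAt_inversion_line ht.1).const_smul s))
  · simp only [Pi.smul_apply, Pi.mul_apply, zero_smul, add_zero]
    rw [show a - 1 - 1 = a - 2 by ring]
    ring

end Inner

theorem kelvin_eq_norm_sq_rpow {n : ℕ} {lam : ℝ} (hlam : 0 < lam)
    (u : EuclideanSpace ℝ (Fin n) → ℝ) :
    kelvin lam u = lam ^ ((n : ℝ) - 2) • fun z : EuclideanSpace ℝ (Fin n) =>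
      (‖z‖ ^ 2) ^ (-((n : ℝ) - 2) / 2) * u (lam ^ 2 • (‖z‖ ^ 2)⁻¹ • z) := by
  ext z
  have h : (‖z‖ ^ 2) ^ (-((n : ℝ) - 2) / 2) = (‖z‖ ^ ((n : ℝ) - 2))⁻¹ := by
    rw [← Real.rpow_natCast, ← Real.rpow_mul (norm_nonneg z), ← Real.rpow_neg (norm_nonneg z)]
    congr 1
    push_cast
    ring
  simp only [kelvin, Pi.smul_apply, smul_eq_mul, h, smul_smul]
  rw [div_eq_mul_inv, div_eq_mul_inv, Real.mul_rpow hlam.le (by positivity),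
    Real.inv_rpow (norm_nonneg z), mul_assoc]

/-- `|y|^{2-n} u(s y/|y|²)` has Laplacian `s² |y|^{-2-n} Δu(s y/|y|²)`. -/
theorem lap_norm_rpow_mul_comp_inversion {n : ℕ} {u : EuclideanSpace ℝ (Fin n) → ℝ}
    {y : EuclideanSpace ℝ (Fin n)} (hy : y ≠ 0) (s : ℝ)
    (hu : ContDiffAt ℝ 2 u (s • (‖y‖ ^ 2)⁻¹ • y)) :
    lap (fun z => (‖z‖ ^ 2) ^ (-((n : ℝ) - 2) / 2) * u (s • (‖z‖ ^ 2)⁻¹ • z)) y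
      = (‖y‖ ^ 2) ^ (-((n : ℝ) - 2) / 2) * (s / ‖y‖ ^ 2) ^ 2
        * lap u (s • (‖y‖ ^ 2)⁻¹ • y) := by
  have hq : 0 < ‖y‖ ^ 2 := by positivity
  have hsum : ∑ i, y i • EuclideanSpace.single i (1 : ℝ) = y := by
    ext j
    simp [Finset.sum_apply, Pi.single_apply]
  have hsq : ∑ i, y i ^ 2 = ‖y‖ ^ 2 := by simp [EuclideanSpace.norm_sq_eq]
  unfold lap
  rw [Finset.sum_congr rfl fun i _ => iteratedFDeriv_two_norm_rpow_mul_comp_inversion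
    (e := EuclideanSpace.single i (1 : ℝ)) (by simp) hy _ s hu]
  simp only [iteratedFDeriv_two_apply, Matrix.cons_val_zero, Matrix.cons_val_one]
  generalize fderiv ℝ (fderiv ℝ u) (s • (‖y‖ ^ 2)⁻¹ • y) = B
  generalize fderiv ℝ u (s • (‖y‖ ^ 2)⁻¹ • y) = L
  generalize u (s • (‖y‖ ^ 2)⁻¹ • y) = U
  have hL : ∑ i, y i * L (EuclideanSpace.single i (1 : ℝ)) = L y := by
    conv_rhs => rw [← hsum]
    simp
  have hB₁ : ∑ i, y i * B (EuclideanSpace.single i (1 : ℝ)) y = B y y := by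
    have := congrArg (fun z => B z y) hsum
    simpa using this
  have hB₂ : ∑ i, y i * B y (EuclideanSpace.single i (1 : ℝ)) = B y y := by
    have := congrArg (fun z => B y z) hsum
    simpa using this
  set a : ℝ := -((n : ℝ) - 2) / 2 with ha
  have hn : (n : ℝ) = 2 - 2 * a := by rw [ha]; ring
  rw [Real.rpow_sub hq, Real.rpow_sub hq, Real.rpow_one, Real.rpow_two]
  generalize (‖y‖ ^ 2) ^ a = C
  generalize ‖y‖ ^ 2 = q at *
  have hterm : ∀ i, inner ℝ y (EuclideanSpace.single i (1 : ℝ)) = y i := fun i => by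
    simp [EuclideanSpace.inner_single_right]
  simp only [hterm, map_smul, map_add, add_apply, smul_apply, smul_eq_mul]
  trans ∑ i, ((2 * a * C / q * U - 2 * C * s / q ^ 2 * L y)
    + (4 * a * (a - 1) * C / q ^ 2 * U - 8 * a * C * s / q ^ 3 * L y
        + 8 * C * s / q ^ 3 * L y + 4 * C * s ^ 2 / q ^ 4 * B y y) * y i ^ 2
    + (4 * a * C * s / q ^ 2 - 4 * C * s / q ^ 2) * (y i * L (EuclideanSpace.single i (1 : ℝ)))
    + (-2 * C * s ^ 2 / q ^ 3) * (y i * B (EuclideanSpace.single i (1 : ℝ)) y)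
    + (-2 * C * s ^ 2 / q ^ 3) * (y i * B y (EuclideanSpace.single i (1 : ℝ)))
    + C * s ^ 2 / q ^ 2
      * B (EuclideanSpace.single i (1 : ℝ)) (EuclideanSpace.single i (1 : ℝ)))
  · refine Finset.sum_congr rfl fun i _ => ?_
    field_simp
    ring
  · simp only [Finset.sum_add_distrib, ← Finset.mul_sum, hsq, hL, hB₁, hB₂, Finset.sum_const,
      Finset.card_univ, Fintype.card_fin, nsmul_eq_mul, hn]
    field_simp
    ring

/-- for a `C²` function `u` on an open set `Ω ⊆ ℝⁿ`, the Kelvin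
transform satisfies `Δ(u^λ)(y) = (λ/|y|)^{n+2} (Δu)(λ²y/|y|²)` at every point `y` of
`Ω* = {y ≠ 0 : λ²y/|y|² ∈ Ω}`. -/
theorem kelvin_laplacian (n : ℕ) (hn : 3 ≤ n) (lam : ℝ) (hlam : 0 < lam)
    (Ω : Set (EuclideanSpace ℝ (Fin n))) (hΩ : IsOpen Ω)
    (u : EuclideanSpace ℝ (Fin n) → ℝ) (hu : ContDiffOn ℝ 2 u Ω) :
    ∀ y : EuclideanSpace ℝ (Fin n), y ≠ 0 → (lam ^ 2 / ‖y‖ ^ 2) • y ∈ Ω →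
      lap (kelvin lam u) y
        = (lam / ‖y‖) ^ ((n : ℝ) + 2) * lap u ((lam ^ 2 / ‖y‖ ^ 2) • y) := by
  intro y hy hmem
  have hx : (lam ^ 2 / ‖y‖ ^ 2) • y = lam ^ 2 • (‖y‖ ^ 2)⁻¹ • y := by
    rw [smul_smul, div_eq_mul_inv]
  have hr : 0 < ‖y‖ := by positivity
  have hu' := hu.contDiffAt (hΩ.mem_nhds hmem)
  rw [hx] at hu' ⊢
  have hsmul : ∀ f : EuclideanSpace ℝ (Fin n) → ℝ, ContDiffAt ℝ 2 f y → ∀ k : ℝ,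
      lap (k • f) y = k * lap f y := fun f hf k => by
    simp [lap, iteratedFDeriv_const_smul_apply hf, Finset.mul_sum]
  have hc : lam ^ ((n : ℝ) - 2) * (‖y‖ ^ 2) ^ (-((n : ℝ) - 2) / 2)
      = (lam / ‖y‖) ^ ((n : ℝ) - 2) := by
    simpa [kelvin] using (congrFun (kelvin_eq_norm_sq_rpow hlam fun _ => (1 : ℝ)) y).symm
  rw [kelvin_eq_norm_sq_rpow hlam, hsmul _ (contDiffAt_norm_rpow_mul_comp_inversion hy _ hu'),
    lap_norm_rpow_mul_comp_inversion hy _ hu',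
    show (n : ℝ) + 2 = (n - 2) + (4 : ℕ) by push_cast; ring, Real.rpow_add (by positivity),
    Real.rpow_natCast, ← hc]
  ring
end

section
/- Let a, b, τ be positive real numbers and 1 < t₁ < t₂. Let η be a positive twice continuously differentiable function on [t₁,t₂] satisfying η''(t) − (a² + b e^{-τt}) η(t) ≤ 0 for t ∈ [t₁,t₂], and suppose η'(t₂) ≥ 0. Then, with f(t) = (b/(2aτ)) e^{-τt}, one has η(t) ≤ η(t₂) · cosh(a(t−t₂) − f(t)) / cosh(f(t₂)) for all t ∈ [t₁,t₂]. Consequently, there is a constant C > 0 depending only on a, b and τ such that t₂ − t ≥ (1/a) ln(η(t)/η(t₂)) − C for all t ∈ [t₁,t₂]. -/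
/-- Sturm-type comparison of a positive supersolution `u` and a positive subsolution `v` of
`y'' = q y`, given the ordering `u' v ≥ u v'` at the right endpoint: the quotient `u / v` is
dominated by its value there. -/
lemma div_le_div_of_supersolution_of_subsolution {s₁ s₂ : ℝ} {q u u' u'' v v' v'' : ℝ → ℝ}
    (hu : ∀ t ∈ Set.Icc s₁ s₂, 0 < u t) (hv : ∀ t ∈ Set.Icc s₁ s₂, 0 < v t)
    (hu' : ∀ t ∈ Set.Icc s₁ s₂, HasDerivAt u (u' t) t)
    (hu'' : ∀ t ∈ Set.Icc s₁ s₂, HasDerivAt u' (u'' t) t)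
    (hv' : ∀ t ∈ Set.Icc s₁ s₂, HasDerivAt v (v' t) t)
    (hv'' : ∀ t ∈ Set.Icc s₁ s₂, HasDerivAt v' (v'' t) t)
    (hsuper : ∀ t ∈ Set.Icc s₁ s₂, u'' t ≤ q t * u t)
    (hsub : ∀ t ∈ Set.Icc s₁ s₂, q t * v t ≤ v'' t)
    (hend : u s₂ * v' s₂ ≤ u' s₂ * v s₂) :
    ∀ t ∈ Set.Icc s₁ s₂, u t / v t ≤ u s₂ / v s₂ := by
  intro t ht
  have hs₂ : s₂ ∈ Set.Icc s₁ s₂ := ⟨ht.1.trans ht.2, le_rfl⟩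
  have hW : ∀ x ∈ Set.Icc s₁ s₂, HasDerivAt (fun y => u' y * v y - u y * v' y)
      (u'' x * v x - u x * v'' x) x := fun x hx =>
    (((hu'' x hx).mul (hv' x hx)).sub ((hu' x hx).mul (hv'' x hx))).congr_deriv (by ring)
  have hWanti : AntitoneOn (fun y => u' y * v y - u y * v' y) (Set.Icc s₁ s₂) := by
    refine antitoneOn_of_hasDerivWithinAt_nonpos (convex_Icc s₁ s₂)
      (fun x hx => (hW x hx).continuousAt.continuousWithinAt)
      (fun x hx => (hW x (interior_subset hx)).hasDerivWithinAt) fun x hx => ?_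
    have hx := interior_subset hx
    have h₁ := mul_le_mul_of_nonneg_right (hsuper x hx) (hv x hx).le
    have h₂ := mul_le_mul_of_nonneg_left (hsub x hx) (hu x hx).le
    linarith
  have hmono : MonotoneOn (fun y => u y / v y) (Set.Icc s₁ s₂) := by
    have hd : ∀ x ∈ Set.Icc s₁ s₂, HasDerivAt (fun y => u y / v y)
        ((u' x * v x - u x * v' x) / v x ^ 2) x :=
      fun x hx => (hu' x hx).div (hv' x hx) (hv x hx).ne'
    refine monotoneOn_of_hasDerivWithinAt_nonneg (convex_Icc s₁ s₂)
      (fun x hx => (hd x hx).continuousAt.continuousWithinAt)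
      (fun x hx => (hd x (interior_subset hx)).hasDerivWithinAt) fun x hx => ?_
    have hx := interior_subset hx
    have hle : u' s₂ * v s₂ - u s₂ * v' s₂ ≤ u' x * v x - u x * v' x := hWanti hx hs₂ hx.2
    exact div_nonneg (by linarith) (sq_nonneg _)
  exact hmono ht hs₂ ht.2

lemma le_mul_cosh_div_cosh_of_supersolution {a b τ s₁ s₂ : ℝ} (ha : 0 < a) (hb : 0 < b)
    (hτ : 0 < τ) {u u' u'' : ℝ → ℝ}
    (hu : ∀ t ∈ Set.Icc s₁ s₂, 0 < u t)
    (hu' : ∀ t ∈ Set.Icc s₁ s₂, HasDerivAt u (u' t) t)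
    (hu'' : ∀ t ∈ Set.Icc s₁ s₂, HasDerivAt u' (u'' t) t)
    (hsuper : ∀ t ∈ Set.Icc s₁ s₂, u'' t - (a ^ 2 + b * Real.exp (-τ * t)) * u t ≤ 0)
    (hend : 0 ≤ u' s₂) :
    ∀ t ∈ Set.Icc s₁ s₂,
      u t ≤ u s₂ * Real.cosh (a * (t - s₂) - b / (2 * a * τ) * Real.exp (-τ * t))
              / Real.cosh (b / (2 * a * τ) * Real.exp (-τ * s₂)) := by
  intro t ht
  have hs₂ : s₂ ∈ Set.Icc s₁ s₂ := ⟨ht.1.trans ht.2, le_rfl⟩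
  set f : ℝ → ℝ := fun x => b / (2 * a * τ) * Real.exp (-τ * x) with hf
  set g : ℝ → ℝ := fun x => a * (x - s₂) - f x with hg
  have hfpos : ∀ x, 0 < f x := fun x => by positivity
  have hfb : ∀ x, b * Real.exp (-τ * x) = 2 * a * τ * f x := fun x => by
    simp only [hf]; field_simp
  have hfd : ∀ x, HasDerivAt f (-τ * f x) x := fun x =>
    (((hasDerivAt_id x).const_mul (-τ)).exp.const_mul (b / (2 * a * τ))).congr_deriv
      (by simp only [hf, id]; ring)
  have hgd : ∀ x, HasDerivAt g (a + τ * f x) x := fun x =>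
    ((((hasDerivAt_id x).sub_const s₂).const_mul a).sub (hfd x)).congr_deriv (by ring)
  have hvd : ∀ x, HasDerivAt (fun y => Real.cosh (g y)) (Real.sinh (g x) * (a + τ * f x)) x :=
    fun x => (hgd x).cosh
  have hvdd : ∀ x, HasDerivAt (fun y => Real.sinh (g y) * (a + τ * f y))
      (Real.cosh (g x) * (a + τ * f x) * (a + τ * f x)
        + Real.sinh (g x) * (τ * (-τ * f x))) x :=
    fun x => (hgd x).sinh.mul (((hfd x).const_mul τ).const_add a)
  have hsinh : ∀ x ≤ s₂, Real.sinh (g x) ≤ 0 := fun x hx => by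
    rw [Real.sinh_nonpos_iff]
    have h := mul_nonneg ha.le (sub_nonneg.2 hx)
    have := hfpos x
    simp only [hg]
    linarith
  have key := div_le_div_of_supersolution_of_subsolution
    (q := fun x => a ^ 2 + b * Real.exp (-τ * x)) hu (fun x _ => Real.cosh_pos (g x)) hu' hu''
    (fun x _ => hvd x) (fun x _ => hvdd x) (fun x hx => sub_nonpos.1 (hsuper x hx))
    (fun x hx => by
      have h₁ : 0 ≤ Real.cosh (g x) * (τ * f x) ^ 2 :=
        mul_nonneg (Real.cosh_pos _).le (sq_nonneg _)
      have h₂ : 0 ≤ -Real.sinh (g x) * (τ ^ 2 * f x) :=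
        mul_nonneg (neg_nonneg.2 (hsinh x hx.2)) (mul_pos (pow_pos hτ 2) (hfpos x)).le
      simp only [hfb]
      linarith)
    (by
      have h₁ : 0 ≤ u' s₂ * Real.cosh (g s₂) := mul_nonneg hend (Real.cosh_pos _).le
      have h₂ : 0 < a + τ * f s₂ := add_pos ha (mul_pos hτ (hfpos s₂))
      have h₃ : u s₂ * (Real.sinh (g s₂) * (a + τ * f s₂)) ≤ 0 :=
        mul_nonpos_of_nonneg_of_nonpos (hu s₂ hs₂).le
          (mul_nonpos_of_nonpos_of_nonneg (hsinh s₂ le_rfl) h₂.le)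
      exact h₃.trans h₁) t ht
  have hgs₂ : Real.cosh (g s₂) = Real.cosh (f s₂) := by simp [hg]
  rw [hgs₂, div_le_iff₀ (Real.cosh_pos _), div_mul_eq_mul_div] at key
  exact key

lemma cosh_le_exp_abs (x : ℝ) : Real.cosh x ≤ Real.exp |x| := by
  rw [← Real.cosh_abs, Real.cosh_eq]
  have : Real.exp (-|x|) ≤ Real.exp |x| :=
    Real.exp_le_exp.2 ((neg_nonpos.2 (abs_nonneg x)).trans (abs_nonneg x))
  linarith


/-- Lemma 6.2 (i): let `a, b, τ > 0` and `1 < t₁ < t₂`, and let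
`η > 0` be `C²` on `[t₁,t₂]` with `η'' - (a² + b e^{-τt}) η ≤ 0` and `η'(t₂) ≥ 0`.
Then, with `f(t) = (b/(2aτ)) e^{-τt}`,
`η(t) ≤ η(t₂) cosh(a(t-t₂) - f(t)) / cosh(f(t₂))` on `[t₁,t₂]`; consequently there is
`C > 0` depending only on `a, b, τ` with `t₂ - t ≥ (1/a) ln(η(t)/η(t₂)) - C`. -/
theorem linear_ode_comparison_right (a b τ : ℝ) (ha : 0 < a) (hb : 0 < b) (hτ : 0 < τ) :
    (∀ t₁ t₂ : ℝ, 1 < t₁ → t₁ < t₂ →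
      ∀ η η' η'' : ℝ → ℝ,
        (∀ t ∈ Set.Icc t₁ t₂, 0 < η t) →
        (∀ t ∈ Set.Icc t₁ t₂, HasDerivAt η (η' t) t) →
        (∀ t ∈ Set.Icc t₁ t₂, HasDerivAt η' (η'' t) t) →
        ContinuousOn η'' (Set.Icc t₁ t₂) →
        (∀ t ∈ Set.Icc t₁ t₂, η'' t - (a ^ 2 + b * Real.exp (-τ * t)) * η t ≤ 0) →
        0 ≤ η' t₂ →
        ∀ t ∈ Set.Icc t₁ t₂,
          η t ≤ η t₂ * Real.cosh (a * (t - t₂) - b / (2 * a * τ) * Real.exp (-τ * t))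
                  / Real.cosh (b / (2 * a * τ) * Real.exp (-τ * t₂))) ∧
    ∃ C : ℝ, 0 < C ∧ ∀ t₁ t₂ : ℝ, 1 < t₁ → t₁ < t₂ →
      ∀ η η' η'' : ℝ → ℝ,
        (∀ t ∈ Set.Icc t₁ t₂, 0 < η t) →
        (∀ t ∈ Set.Icc t₁ t₂, HasDerivAt η (η' t) t) →
        (∀ t ∈ Set.Icc t₁ t₂, HasDerivAt η' (η'' t) t) →
        ContinuousOn η'' (Set.Icc t₁ t₂) →
        (∀ t ∈ Set.Icc t₁ t₂, η'' t - (a ^ 2 + b * Real.exp (-τ * t)) * η t ≤ 0) →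
        0 ≤ η' t₂ →
        ∀ t ∈ Set.Icc t₁ t₂,
          t₂ - t ≥ (1 / a) * Real.log (η t / η t₂) - C := by
  refine ⟨fun t₁ t₂ _ _ η η' η'' hη hη' hη'' _ hode hend =>
    le_mul_cosh_div_cosh_of_supersolution ha hb hτ hη hη' hη'' hode hend,
    b / (2 * a * τ) / a, by positivity, ?_⟩
  intro t₁ t₂ h₁ _ η η' η'' hη hη' hη'' _ hode hend t ht
  have hle := le_mul_cosh_div_cosh_of_supersolution ha hb hτ hη hη' hη'' hode hend t ht
  have ht₂ : 0 < η t₂ := hη t₂ ⟨ht.1.trans ht.2, le_rfl⟩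
  set c := b / (2 * a * τ) with hc
  have hcpos : 0 < c := by positivity
  have hexp : Real.exp (-τ * t) ≤ 1 := Real.exp_le_one_iff.2 (by nlinarith [ht.1])
  have hfc : c * Real.exp (-τ * t) ≤ c := mul_le_of_le_one_right hcpos.le hexp
  have hf0 : 0 < c * Real.exp (-τ * t) := by positivity
  have hat : 0 ≤ a * (t₂ - t) := mul_nonneg ha.le (sub_nonneg.2 ht.2)
  have habs : |a * (t - t₂) - c * Real.exp (-τ * t)| ≤ a * (t₂ - t) + c :=
    abs_le.2 ⟨by linarith, by linarith⟩
  have hratio : η t / η t₂ ≤ Real.exp (a * (t₂ - t) + c) := by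
    rw [div_le_iff₀ ht₂, mul_comm]
    calc η t ≤ _ := hle
      _ ≤ η t₂ * Real.cosh (a * (t - t₂) - c * Real.exp (-τ * t)) :=
        div_le_self (mul_pos ht₂ (Real.cosh_pos _)).le (Real.one_le_cosh _)
      _ ≤ _ := mul_le_mul_of_nonneg_left
        ((cosh_le_exp_abs _).trans (Real.exp_le_exp.2 habs)) ht₂.le
  have hlog : Real.log (η t / η t₂) ≤ a * (t₂ - t) + c :=
    (Real.log_le_iff_le_exp (div_pos (hη t ht) ht₂)).2 hratio
  have hdiv : Real.log (η t / η t₂) / a ≤ (t₂ - t) + c / a := by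
    rw [div_le_iff₀ ha, add_mul, div_mul_cancel₀ _ ha.ne']
    linarith
  rw [one_div_mul_eq_div]
  linarith
end

section
/- Let a, b, τ > 0 and t₂ ∈ ℝ. Define f(t) = (b/(2aτ)) e^{-τt} and ζ(t) = cosh(a(t − t₂) − f(t)). Then for every t ≤ t₂, ζ''(t) − (a² + b e^{-τt}) ζ(t) ≥ 0, and moreover ζ'(t₂) ≤ 0. -/
theorem hasDerivAt_affine_sub_mul_exp (a c τ t₂ t : ℝ) :
    HasDerivAt (fun s : ℝ => a * (s - t₂) - c * Real.exp (-τ * s))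
      (a + c * τ * Real.exp (-τ * t)) t := by
  have h₁ : HasDerivAt (fun s : ℝ => a * (s - t₂)) (a * 1) t :=
    ((hasDerivAt_id t).sub_const t₂).const_mul a
  have h₂ : HasDerivAt (fun s : ℝ => c * Real.exp (-τ * s))
      (c * (Real.exp (-τ * t) * (-τ * 1))) t :=
    (((hasDerivAt_id t).const_mul (-τ)).exp).const_mul c
  exact (h₁.sub h₂).congr_deriv (by ring)

theorem deriv_cosh_affine_sub_mul_exp (a c τ t₂ : ℝ) :
    deriv (fun s : ℝ => Real.cosh (a * (s - t₂) - c * Real.exp (-τ * s))) =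
      fun s => Real.sinh (a * (s - t₂) - c * Real.exp (-τ * s)) *
        (a + c * τ * Real.exp (-τ * s)) :=
  funext fun t => (hasDerivAt_affine_sub_mul_exp a c τ t₂ t).cosh.deriv

theorem iteratedDeriv_two_cosh_affine_sub_mul_exp (a c τ t₂ t : ℝ) :
    iteratedDeriv 2 (fun s : ℝ => Real.cosh (a * (s - t₂) - c * Real.exp (-τ * s))) t =
      Real.cosh (a * (t - t₂) - c * Real.exp (-τ * t)) *
          (a + c * τ * Real.exp (-τ * t)) ^ 2 -
        Real.sinh (a * (t - t₂) - c * Real.exp (-τ * t)) *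
          (c * τ ^ 2 * Real.exp (-τ * t)) := by
  rw [iteratedDeriv_succ, iteratedDeriv_one, deriv_cosh_affine_sub_mul_exp]
  have h : HasDerivAt (fun s : ℝ => a + c * τ * Real.exp (-τ * s))
      (c * τ * (Real.exp (-τ * t) * (-τ * 1))) t :=
    ((((hasDerivAt_id t).const_mul (-τ)).exp).const_mul (c * τ)).const_add a
  refine ((hasDerivAt_affine_sub_mul_exp a c τ t₂ t).sinh.mul h).deriv.trans ?_
  ring

/-- explicit supersolution from the proof of Lemma 6.2: for
`a, b, τ > 0`, `f(t) = (b/(2aτ)) e^{-τt}` and `ζ(t) = cosh(a(t - t₂) - f(t))`, one has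
`ζ'' - (a² + b e^{-τt}) ζ ≥ 0` for all `t ≤ t₂`, and `ζ'(t₂) ≤ 0`. -/
theorem explicit_supersolution (a b τ t₂ : ℝ) (ha : 0 < a) (hb : 0 < b) (hτ : 0 < τ) :
    (∀ t : ℝ, t ≤ t₂ →
      0 ≤ iteratedDeriv 2
            (fun s : ℝ => Real.cosh (a * (s - t₂) - b / (2 * a * τ) * Real.exp (-τ * s))) t
          - (a ^ 2 + b * Real.exp (-τ * t)) *
              Real.cosh (a * (t - t₂) - b / (2 * a * τ) * Real.exp (-τ * t))) ∧
    deriv (fun s : ℝ => Real.cosh (a * (s - t₂) - b / (2 * a * τ) * Real.exp (-τ * s))) t₂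
      ≤ 0 := by
  have hc : 0 < b / (2 * a * τ) := by positivity
  have hcτ : 2 * a * (b / (2 * a * τ) * τ) = b := by field_simp
  generalize b / (2 * a * τ) = c at hc hcτ ⊢
  have hsinh : ∀ t ≤ t₂, Real.sinh (a * (t - t₂) - c * Real.exp (-τ * t)) ≤ 0 := by
    intro t ht
    rw [Real.sinh_nonpos_iff]
    have h₁ : a * (t - t₂) ≤ 0 := mul_nonpos_of_nonneg_of_nonpos ha.le (sub_nonpos.2 ht)
    have h₂ : 0 < c * Real.exp (-τ * t) := by positivity
    linarith
  refine ⟨fun t ht => ?_, ?_⟩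
  · rw [iteratedDeriv_two_cosh_affine_sub_mul_exp, ← hcτ]
    have h₁ : 0 ≤ Real.cosh (a * (t - t₂) - c * Real.exp (-τ * t)) *
        (c * τ * Real.exp (-τ * t)) ^ 2 := mul_nonneg (Real.cosh_pos _).le (sq_nonneg _)
    have h₂ := mul_nonpos_of_nonpos_of_nonneg (hsinh t ht)
      (by positivity : 0 ≤ c * τ ^ 2 * Real.exp (-τ * t))
    linear_combination h₁ + h₂
  · rw [deriv_cosh_affine_sub_mul_exp]
    exact mul_nonpos_of_nonpos_of_nonneg (hsinh t₂ le_rfl) (by positivity)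
end

section
/- Let n ≥ 3 be an integer and b, c, τ > 0. Then there exist positive constants t*, ε₀, C₁, C₂ depending only on b, c, n and τ with the following property: whenever t* ≤ t₁ < t₂ and w is a positive twice continuously differentiable function on [t₁,t₂] satisfying w''(t) − ((n-2)/2)² (1 − b e^{-τt}) w(t) + (n(n−2)c/4) w(t)^{(n+2)/(n-2)} ≥ 0 and w(t) ≤ ε₀ for all t ∈ [t₁,t₂], and additionally w'(t₂) ≤ 0, then t₂ − t ≤ (2/(n−2) + C₁ e^{-τ t₁}) ln(w(t)/w(t₂)) + C₂ for all t ∈ [t₁,t₂]. -/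
open Real Set

/-- If `w'' > 0` and `w' ≤ 0` at the right endpoint, then `w' < 0` away from that endpoint. -/
lemma deriv_neg_of_second_deriv_pos {t₁ t₂ : ℝ} {w' w'' : ℝ → ℝ}
    (hw' : ∀ t ∈ Icc t₁ t₂, HasDerivAt w' (w'' t) t)
    (hpos : ∀ t ∈ Icc t₁ t₂, 0 < w'' t) (hend : w' t₂ ≤ 0) :
    ∀ t ∈ Ico t₁ t₂, w' t < 0 := by
  intro t ht
  have hmono : StrictMonoOn w' (Icc t₁ t₂) :=
    strictMonoOn_of_hasDerivWithinAt_pos (convex_Icc _ _)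
      (fun x hx => (hw' x hx).continuousAt.continuousWithinAt)
      (fun x hx => (hw' x (interior_subset hx)).hasDerivWithinAt)
      (fun x hx => hpos x (interior_subset hx))
  exact (hmono ⟨ht.1, ht.2.le⟩ ⟨ht.1.trans ht.2.le, le_rfl⟩ ht.2).trans_le hend

lemma strictAntiOn_of_second_deriv_pos {t₁ t₂ : ℝ} {w w' w'' : ℝ → ℝ}
    (hw : ∀ t ∈ Icc t₁ t₂, HasDerivAt w (w' t) t)
    (hw' : ∀ t ∈ Icc t₁ t₂, HasDerivAt w' (w'' t) t)
    (hpos : ∀ t ∈ Icc t₁ t₂, 0 < w'' t) (hend : w' t₂ ≤ 0) :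
    StrictAntiOn w (Icc t₁ t₂) :=
  strictAntiOn_of_hasDerivWithinAt_neg (convex_Icc _ _)
    (fun x hx => (hw x hx).continuousAt.continuousWithinAt)
    (fun x hx => (hw x (interior_subset hx)).hasDerivWithinAt)
    (fun x hx => by
      rw [interior_Icc] at hx
      exact deriv_neg_of_second_deriv_pos hw' hpos hend x ⟨hx.1.le, hx.2⟩)

/-- Energy inequality for nonincreasing solutions of `w'' ≥ κ w`. -/
lemma energy_le_deriv_sq {t₁ t₂ κ : ℝ} {w w' w'' : ℝ → ℝ} (h12 : t₁ ≤ t₂)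
    (hw : ∀ t ∈ Icc t₁ t₂, HasDerivAt w (w' t) t)
    (hw' : ∀ t ∈ Icc t₁ t₂, HasDerivAt w' (w'' t) t)
    (hineq : ∀ t ∈ Icc t₁ t₂, κ * w t ≤ w'' t)
    (hneg : ∀ t ∈ Icc t₁ t₂, w' t ≤ 0) :
    κ * (w t₁ ^ 2 - w t₂ ^ 2) ≤ w' t₁ ^ 2 := by
  have hd : ∀ t ∈ Icc t₁ t₂, HasDerivAt (fun s => w' s ^ 2 - κ * w s ^ 2)
      (2 * w' t * (w'' t - κ * w t)) t := by
    intro t ht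
    refine (((hw' t ht).pow 2).sub (((hw t ht).pow 2).const_mul κ)).congr_deriv ?_
    norm_num
    ring
  have hanti : AntitoneOn (fun s => w' s ^ 2 - κ * w s ^ 2) (Icc t₁ t₂) :=
    antitoneOn_of_hasDerivWithinAt_nonpos (convex_Icc _ _)
      (fun x hx => (hd x hx).continuousAt.continuousWithinAt)
      (fun x hx => (hd x (interior_subset hx)).hasDerivWithinAt)
      (fun x hx => by
        have h1 := hneg x (interior_subset hx)
        have h2 := hineq x (interior_subset hx)
        exact mul_nonpos_of_nonpos_of_nonneg (by linarith) (by linarith))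
  have := hanti ⟨le_rfl, h12⟩ ⟨h12, le_rfl⟩ h12
  simp only at this
  nlinarith [sq_nonneg (w' t₂)]

lemma one_le_sqrt_mul_inv_add {a y : ℝ} (ha : 0 < a) (ha2 : 1 / 2 ≤ a ^ 2)
    (hy0 : 0 ≤ y) (hy : y ≤ 1 / 4) : 1 ≤ √(a ^ 2 - y) * (1 / a + 4 * y) := by
  have hk : 0 ≤ a ^ 2 - y := by linarith
  have hahalf : 1 / 2 ≤ a := by nlinarith
  set h := y / a ^ 2 with hh
  have hyh : y = a ^ 2 * h := by rw [hh]; field_simp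
  have hh0 : 0 ≤ h := by positivity
  have hh1 : h ≤ 1 / 2 := by rw [hh, div_le_iff₀ (by positivity)]; linarith
  have h1 : 1 / a * (1 + h) ≤ 1 / a + 4 * y := by
    have : h / a ≤ 4 * y := by
      rw [div_le_iff₀ ha, hyh]
      have : 1 ≤ 4 * (a ^ 2 * a) := by nlinarith
      nlinarith
    calc 1 / a * (1 + h) = 1 / a + h / a := by ring
      _ ≤ _ := by linarith
  have h2 : √(a ^ 2 - y) = a * √(1 - h) := by
    rw [hyh, show a ^ 2 - a ^ 2 * h = a ^ 2 * (1 - h) by ring, Real.sqrt_mul (sq_nonneg a),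
      Real.sqrt_sq ha.le]
  have h3 : 1 - h ≤ (√(1 - h)) ^ 2 := (Real.sq_sqrt (by linarith)).ge
  have h4 : 1 ≤ √(1 - h) * (1 + h) := by
    by_contra! hc
    have h5 : 0 ≤ √(1 - h) * (1 + h) := by positivity
    have h6 : (√(1 - h) * (1 + h)) ^ 2 < 1 := by nlinarith
    rw [mul_pow, Real.sq_sqrt (by linarith)] at h6
    nlinarith [mul_nonneg hh0 hh0]
  calc 1 ≤ √(1 - h) * (1 + h) := h4
    _ = √(a ^ 2 - y) * (1 / a * (1 + h)) := by rw [h2]; field_simp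
    _ ≤ _ := by gcongr

/-- Decay estimate for positive solutions of `w'' ≥ m² (a² - k w ^ p) w` with `w' ≤ 0` at the
right endpoint. -/
lemma mul_sub_le_log_add_rpow {t₁ t₂ m a k p : ℝ} {w w' w'' : ℝ → ℝ}
    (hm : 0 < m) (ha : 0 < a) (ha2 : 1 / 2 ≤ a ^ 2) (hk : 0 < k) (hp : 0 < p)
    (hpos : ∀ t ∈ Icc t₁ t₂, 0 < w t)
    (hw : ∀ t ∈ Icc t₁ t₂, HasDerivAt w (w' t) t)
    (hw' : ∀ t ∈ Icc t₁ t₂, HasDerivAt w' (w'' t) t)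
    (hineq : ∀ t ∈ Icc t₁ t₂, m ^ 2 * (a ^ 2 - k * w t ^ p) * w t ≤ w'' t)
    (hsmall : ∀ t ∈ Icc t₁ t₂, k * w t ^ p ≤ 1 / 4)
    (hend : w' t₂ ≤ 0) :
    ∀ t ∈ Icc t₁ t₂,
      m * (t₂ - t) ≤ 1 / a * (log (w t / w t₂) + log 2) + 4 * k / p * (2 * w t) ^ p := by
  intro t ht
  have h12 : t₁ ≤ t₂ := ht.1.trans ht.2
  have ht₂ : t₂ ∈ Icc t₁ t₂ := ⟨h12, le_rfl⟩
  have hw''pos : ∀ t ∈ Icc t₁ t₂, 0 < w'' t := fun s hs => by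
    refine lt_of_lt_of_le (mul_pos (mul_pos (by positivity) ?_) (hpos s hs)) (hineq s hs)
    linarith [hsmall s hs]
  have hneg := deriv_neg_of_second_deriv_pos hw' hw''pos hend
  have hcont : ContinuousOn w (Icc t₁ t₂) :=
    fun x hx => (hw x hx).continuousAt.continuousWithinAt
  have hanti : StrictAntiOn w (Icc t₁ t₂) :=
    strictAntiOn_of_second_deriv_pos hw hw' hw''pos hend
  have hneg' : ∀ t ∈ Icc t₁ t₂, w' t ≤ 0 := fun s hs => by
    rcases hs.2.eq_or_lt with h | h
    · rwa [h]
    · exact (hneg s ⟨hs.1, h⟩).le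
  have henergy : ∀ s ∈ Icc t₁ t₂,
      m ^ 2 * (a ^ 2 - k * w s ^ p) * (w s ^ 2 - w t₂ ^ 2) ≤ w' s ^ 2 := by
    intro s hs
    have hsub : ∀ r ∈ Icc s t₂, r ∈ Icc t₁ t₂ := fun r hr => ⟨hs.1.trans hr.1, hr.2⟩
    refine energy_le_deriv_sq hs.2 (fun r hr => hw r (hsub r hr))
      (fun r hr => hw' r (hsub r hr)) (fun r hr => ?_) (fun r hr => hneg' r (hsub r hr))
    have hr' := hsub r hr
    have hle : w r ≤ w s := hanti.antitoneOn hs hr' hr.1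
    have := hpos r hr'
    refine le_trans ?_ (hineq r hr')
    gcongr
  set D : ℝ → ℝ := fun s => √(w s ^ 2 - w t₂ ^ 2) with hD
  set E : ℝ → ℝ := fun s => w s + D s with hE
  have hEpos : ∀ s ∈ Icc t₁ t₂, 0 < E s := fun s hs =>
    add_pos_of_pos_of_nonneg (hpos s hs) (Real.sqrt_nonneg _)
  set G : ℝ → ℝ := fun s => 1 / a * log (E s) + 4 * k / p * E s ^ p + m * s with hG
  have hEcont : ContinuousOn E (Icc t₁ t₂) :=
    hcont.add (((hcont.pow 2).sub continuousOn_const).sqrt)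
  have hGcont : ContinuousOn G (Icc t₁ t₂) :=
    ((continuousOn_const.mul (hEcont.log fun s hs => (hEpos s hs).ne')).add
      (continuousOn_const.mul (hEcont.rpow_const fun s hs => Or.inl (hEpos s hs).ne'))).add
      (continuousOn_const.mul continuousOn_id)
  have hgap : ∀ s ∈ Ioo t₁ t₂, 0 < w s ^ 2 - w t₂ ^ 2 := fun s hs => by
    have h1 := hanti (Ioo_subset_Icc_self hs) ht₂ hs.2
    have h2 := hpos t₂ ht₂
    nlinarith
  have hGderiv : ∀ s ∈ Ioo t₁ t₂,
      HasDerivAt G (w' s / D s * (1 / a + 4 * k * E s ^ p) + m) s := by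
    intro s hs
    have hs' := Ioo_subset_Icc_self hs
    have hDpos : 0 < D s := Real.sqrt_pos.2 (hgap s hs)
    have hEd : HasDerivAt E (w' s / D s * E s) s := by
      refine ((hw s hs').add ((((hw s hs').pow 2).sub_const (w t₂ ^ 2)).sqrt
        (hgap s hs).ne')).congr_deriv ?_
      change _ + _ / (2 * D s) = w' s / D s * (w s + D s)
      field_simp
      norm_num
      ring
    have hE0 := hEpos s hs'
    refine ((((hEd.log hE0.ne').const_mul (1 / a)).add
      ((hEd.rpow_const (p := p) (Or.inl hE0.ne')).const_mul (4 * k / p))).add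
      ((hasDerivAt_id s).const_mul m)).congr_deriv ?_
    rw [Real.rpow_sub_one hE0.ne']
    field_simp
  have hGanti : AntitoneOn G (Icc t₁ t₂) := by
    refine antitoneOn_of_hasDerivWithinAt_nonpos (convex_Icc _ _) hGcont
      (f' := fun s => w' s / D s * (1 / a + 4 * k * E s ^ p) + m) ?_ ?_
    · rw [interior_Icc]
      exact fun s hs => (hGderiv s hs).hasDerivWithinAt
    · rw [interior_Icc]
      intro s hs
      have hs' := Ioo_subset_Icc_self hs
      have hDpos : 0 < D s := Real.sqrt_pos.2 (hgap s hs)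
      have hws := hpos s hs'
      have hy := hsmall s hs'
      have hr := one_le_sqrt_mul_inv_add ha ha2 (by positivity) hy
      set r := √(a ^ 2 - k * w s ^ p) with hrdef
      have hr0 : 0 ≤ r := Real.sqrt_nonneg _
      have hslope : m * r * D s ≤ -w' s := by
        refine abs_le_of_sq_le_sq' ?_ (by linarith [hneg' s hs']) |>.2
        rw [neg_sq, mul_pow, mul_pow, Real.sq_sqrt (by linarith), Real.sq_sqrt (hgap s hs).le]
        exact henergy s hs'
      have hquot : w' s / D s ≤ -(m * r) := by
        rw [div_le_iff₀ hDpos]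
        linarith
      have hEw : w s ^ p ≤ E s ^ p :=
        Real.rpow_le_rpow hws.le (le_add_of_nonneg_right hDpos.le) hp.le
      have hq : 1 / a + 4 * (k * w s ^ p) ≤ 1 / a + 4 * k * E s ^ p := by
        rw [← mul_assoc]
        gcongr
      have hfac : 0 ≤ 1 / a + 4 * k * E s ^ p := by
        have := hEpos s hs'
        positivity
      have h1 := mul_le_mul_of_nonneg_right hquot hfac
      have h2 : 1 ≤ r * (1 / a + 4 * k * E s ^ p) :=
        hr.trans (mul_le_mul_of_nonneg_left hq hr0)
      nlinarith
  have hcmp := hGanti ht ht₂ ht.2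
  have hE₂ : E t₂ = w t₂ := by simp [hE, hD]
  have hw0 := hpos t ht
  have hw2 := hpos t₂ ht₂
  have hElt : E t ≤ 2 * w t := by
    have : D t ≤ w t := Real.sqrt_le_iff.2 ⟨hw0.le, by nlinarith⟩
    simp only [hE]
    linarith
  have hlog : log (E t) ≤ log 2 + log (w t) := by
    rw [← Real.log_mul two_ne_zero hw0.ne']
    exact Real.log_le_log (hEpos t ht) hElt
  have hpow : 4 * k / p * E t ^ p ≤ 4 * k / p * (2 * w t) ^ p := by
    have := (hEpos t ht).le
    gcongr
  have hlast : 0 ≤ 4 * k / p * w t₂ ^ p := by positivity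
  simp only [hG, hE₂] at hcmp
  rw [Real.log_div hw0.ne' hw2.ne']
  have := mul_le_mul_of_nonneg_left hlog (by positivity : (0 : ℝ) ≤ 1 / a)
  linarith


/-- Lemma 6.3 (i): for `n ≥ 3` and `b, c, τ > 0` there are positive
constants `t*, ε₀, C₁, C₂` depending only on `b, c, n, τ` such that any positive `C²`
function `w ≤ ε₀` on `[t₁,t₂]` (with `t* ≤ t₁ < t₂`) satisfying
`w'' - ((n-2)/2)²(1 - b e^{-τt}) w + (n(n-2)c/4) w^{(n+2)/(n-2)} ≥ 0` and `w'(t₂) ≤ 0`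
obeys `t₂ - t ≤ (2/(n-2) + C₁ e^{-τ t₁}) ln(w(t)/w(t₂)) + C₂` on `[t₁,t₂]`. -/
theorem nonlinear_ode_comparison_right (n : ℕ) (hn : 3 ≤ n) (b c τ : ℝ)
    (hb : 0 < b) (hc : 0 < c) (hτ : 0 < τ) :
    ∃ tstar ε₀ C₁ C₂ : ℝ, 0 < tstar ∧ 0 < ε₀ ∧ 0 < C₁ ∧ 0 < C₂ ∧
      ∀ t₁ t₂ : ℝ, tstar ≤ t₁ → t₁ < t₂ →
        ∀ w w' w'' : ℝ → ℝ,
          (∀ t ∈ Set.Icc t₁ t₂, 0 < w t) →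
          (∀ t ∈ Set.Icc t₁ t₂, HasDerivAt w (w' t) t) →
          (∀ t ∈ Set.Icc t₁ t₂, HasDerivAt w' (w'' t) t) →
          ContinuousOn w'' (Set.Icc t₁ t₂) →
          (∀ t ∈ Set.Icc t₁ t₂,
            0 ≤ w'' t - (((n : ℝ) - 2) / 2) ^ 2 * (1 - b * Real.exp (-τ * t)) * w t
                + (n : ℝ) * ((n : ℝ) - 2) * c / 4 *
                    w t ^ (((n : ℝ) + 2) / ((n : ℝ) - 2))) →
          (∀ t ∈ Set.Icc t₁ t₂, w t ≤ ε₀) →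
          w' t₂ ≤ 0 →
          ∀ t ∈ Set.Icc t₁ t₂,
            t₂ - t ≤ (2 / ((n : ℝ) - 2) + C₁ * Real.exp (-τ * t₁)) *
                Real.log (w t / w t₂) + C₂ := by
  have hn' : (3 : ℝ) ≤ n := by exact_mod_cast hn
  obtain ⟨m, hmdef⟩ : ∃ m : ℝ, m = ((n : ℝ) - 2) / 2 := ⟨_, rfl⟩
  have hnm : (n : ℝ) = 2 * m + 2 := by linarith
  have hnm2 : (n : ℝ) - 2 = 2 * m := by linarith
  have hm : 0 < m := by linarith
  set k : ℝ := c * (m + 1) / m with hkdef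
  have hk : 0 < k := by positivity
  set p : ℝ := 2 / m with hpdef
  have hp : 0 < p := by positivity
  set ε : ℝ := (1 / (4 * k)) ^ (1 / p) with hεdef
  have hε : 0 < ε := by positivity
  have hεp : k * ε ^ p = 1 / 4 := by
    rw [hεdef, ← Real.rpow_mul (by positivity), one_div_mul_cancel hp.ne', Real.rpow_one]
    field_simp
  have hlog2 : 0 < log 2 := Real.log_pos one_lt_two
  refine ⟨2 * b / τ, ε, 2 * b / m, (2 * log 2 + 4 * k / p * (2 * ε) ^ p) / m, by positivity, hε,
    by positivity, by positivity, ?_⟩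
  intro t₁ t₂ ht₁ _ w w' w'' hpos hw hw' _ hineq hsmall hend t ht
  set δ : ℝ := b * exp (-τ * t₁) with hδdef
  have hδ0 : 0 < δ := by positivity
  have hδ : δ ≤ 1 / 2 := by
    have h1 : 2 * b ≤ τ * t₁ := by
      rw [div_le_iff₀ hτ] at ht₁
      linarith
    have h2 := Real.add_one_le_exp (τ * t₁)
    rw [hδdef, neg_mul, Real.exp_neg, ← div_eq_mul_inv, div_le_iff₀ (Real.exp_pos _)]
    linarith
  set a : ℝ := √(1 - δ) with hadef
  have ha : 0 < a := Real.sqrt_pos.2 (by linarith)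
  have ha2 : a ^ 2 = 1 - δ := Real.sq_sqrt (by linarith)
  have hle : ∀ s ∈ Icc t₁ t₂, m ^ 2 * (a ^ 2 - k * w s ^ p) * w s ≤ w'' s := by
    intro s hs
    have hws := hpos s hs
    have h := hineq s hs
    have hexp : b * exp (-τ * s) ≤ δ :=
      mul_le_mul_of_nonneg_left (Real.exp_le_exp.2 (by nlinarith [hs.1])) hb.le
    have hpw : w s ^ (((n : ℝ) + 2) / ((n : ℝ) - 2)) = w s * w s ^ p := by
      rw [← Real.rpow_one_add' hws.le (by positivity)]
      congr 1
      rw [hpdef, hnm2, hnm]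
      field_simp
      ring
    have hK : (n : ℝ) * ((n : ℝ) - 2) * c / 4 = m ^ 2 * k := by
      rw [hkdef, hnm]
      field_simp
      ring
    rw [hpw, hK, ← hmdef] at h
    rw [ha2]
    have h3 : m ^ 2 * (b * exp (-τ * s)) * w s ≤ m ^ 2 * δ * w s := by gcongr
    linarith
  have hsm : ∀ s ∈ Icc t₁ t₂, k * w s ^ p ≤ 1 / 4 := fun s hs => by
    rw [← hεp]
    have := hpos s hs
    have := hsmall s hs
    gcongr
  have hmain := mul_sub_le_log_add_rpow hm ha (by linarith) hk hp hpos hw hw' hle hsm hend t ht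
  have hanti : w t₂ ≤ w t :=
    (strictAntiOn_of_second_deriv_pos hw hw' (fun s hs => lt_of_lt_of_le
      (mul_pos (mul_pos (by positivity) (by linarith [hsm s hs])) (hpos s hs)) (hle s hs))
      hend).antitoneOn ht ⟨ht.1.trans ht.2, le_rfl⟩ ht.2
  have hw0 := hpos t ht
  have hw2 := hpos t₂ ⟨ht.1.trans ht.2, le_rfl⟩
  have hL : 0 ≤ log (w t / w t₂) := Real.log_nonneg ((one_le_div hw2).2 hanti)
  have hinv : 1 / a ≤ 1 + 2 * δ := by
    rw [div_le_iff₀ ha]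
    have : 1 - δ ≤ a := by nlinarith
    nlinarith
  have hpow : 4 * k / p * (2 * w t) ^ p ≤ 4 * k / p * (2 * ε) ^ p := by
    have := hsmall t ht
    gcongr
  have hcoef : 2 / ((n : ℝ) - 2) + 2 * b / m * exp (-τ * t₁) = (1 + 2 * δ) / m := by
    rw [hδdef, hnm2]
    field_simp
  rw [hcoef, div_mul_eq_mul_div, ← add_div, le_div_iff₀ hm]
  have h1 := mul_le_mul_of_nonneg_right hinv hL
  have h2 : 1 / a * log 2 ≤ 2 * log 2 :=
    mul_le_mul_of_nonneg_right (by linarith) hlog2.le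
  linarith
end

section
/- Let n ≥ 3 be an integer and b, c, τ > 0. Then there exist positive constants t*, ε₀, C₁, C₂ depending only on b, c, n and τ with the following property: whenever t* ≤ t₁ < t₂ and w is a positive twice continuously differentiable function on [t₁,t₂] satisfying w''(t) − ((n-2)/2)² (1 − b e^{-τt}) w(t) + (n(n−2)c/4) w(t)^{(n+2)/(n-2)} ≥ 0 and w(t) ≤ ε₀ for all t ∈ [t₁,t₂], and additionally w'(t₁) ≥ 0, then t − t₁ ≤ (2/(n−2) + C₁ e^{-τ t₁}) ln(w(t)/w(t₁)) + C₂ for all t ∈ [t₁,t₂]. -/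
/-- A function with nonnegative derivative on `[t₁,t₂]` is monotone there. -/
lemma monotoneOn_Icc_of_hasDerivAt_nonneg {f f' : ℝ → ℝ} {t₁ t₂ : ℝ}
    (hf : ∀ t ∈ Set.Icc t₁ t₂, HasDerivAt f (f' t) t)
    (hf' : ∀ t ∈ Set.Icc t₁ t₂, 0 ≤ f' t) : MonotoneOn f (Set.Icc t₁ t₂) := by
  refine monotoneOn_of_hasDerivWithinAt_nonneg (f' := f') (convex_Icc _ _)
    (fun t ht => (hf t ht).continuousAt.continuousWithinAt)
    (fun t ht => (hf t (interior_subset ht)).hasDerivWithinAt)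
    (fun t ht => hf' t (interior_subset ht))

/-- The pointwise inequality behind the Lyapunov function used in
`sub_le_log_div_of_fowler_inequality`. Here `v` is the logarithmic derivative of the solution,
`v'` its derivative, and `z` the size of the nonlinear term. -/
lemma riccati_lyapunov_bound {a v v' z : ℝ} (ha : 0 < a) (hv : 0 ≤ v) (hz : 0 ≤ z)
    (hza : z ≤ a ^ 2 / 8) (hv' : a ^ 2 - z - v ^ 2 ≤ v') :
    a ≤ v + 2 * a * v' / (a + v) ^ 2 + 4 / a ^ 2 * (v * z) := by
  have hpos : 0 < a + v := by linarith
  have h1 : 2 * a * (a ^ 2 - z - v ^ 2) / (a + v) ^ 2 ≤ 2 * a * v' / (a + v) ^ 2 := by gcongr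
  suffices h : 0 ≤ v + 2 * a * (a ^ 2 - z - v ^ 2) / (a + v) ^ 2 + 4 / a ^ 2 * (v * z) - a by
    linarith
  have key : 0 ≤ a ^ 2 * ((a - v) ^ 2 * (a + v) - 2 * a * z) + 4 * (v * z) * (a + v) ^ 2 := by
    rcases le_total v (a / 2) with h | h
    · have h2 : (a / 2) ^ 2 * a ≤ (a - v) ^ 2 * (a + v) := by
        gcongr <;> linarith
      have h3 : 2 * a * z ≤ (a / 2) ^ 2 * a := by nlinarith
      have h4 : 0 ≤ (a - v) ^ 2 * (a + v) - 2 * a * z := by linarith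
      positivity
    · have h2 : 0 ≤ a ^ 2 * ((a - v) ^ 2 * (a + v)) := by positivity
      have h3 : 4 * (a / 2 * z) * a ^ 2 ≤ 4 * (v * z) * (a + v) ^ 2 := by
        gcongr
        linarith
      linarith
  have heq : v + 2 * a * (a ^ 2 - z - v ^ 2) / (a + v) ^ 2 + 4 / a ^ 2 * (v * z) - a =
      (a ^ 2 * ((a - v) ^ 2 * (a + v) - 2 * a * z) + 4 * (v * z) * (a + v) ^ 2) /
        (a ^ 2 * (a + v) ^ 2) := by
    field_simp
    ring
  rw [heq]
  positivity

/-- A small positive function that satisfies `w'' ≥ a² w - K w^{1+δ}` and has `w'(t₁) ≥ 0` is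
monotone and grows at least like `e^{a t}` up to a constant factor. -/
lemma sub_le_log_div_of_fowler_inequality {a K δ t₁ t₂ : ℝ} {w w' w'' : ℝ → ℝ}
    (ha : 0 < a) (hK : 0 < K) (hδ : 0 < δ)
    (hpos : ∀ t ∈ Set.Icc t₁ t₂, 0 < w t)
    (hw : ∀ t ∈ Set.Icc t₁ t₂, HasDerivAt w (w' t) t)
    (hw' : ∀ t ∈ Set.Icc t₁ t₂, HasDerivAt w' (w'' t) t)
    (hode : ∀ t ∈ Set.Icc t₁ t₂, (a ^ 2 - K * w t ^ δ) * w t ≤ w'' t)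
    (hsmall : ∀ t ∈ Set.Icc t₁ t₂, K * w t ^ δ ≤ a ^ 2 / 8)
    (h0 : 0 ≤ w' t₁) {t : ℝ} (ht : t ∈ Set.Icc t₁ t₂) :
    w t₁ ≤ w t ∧ t - t₁ ≤ (Real.log (w t / w t₁) + (2 + 1 / (2 * δ))) / a := by
  have ht₁ : t₁ ∈ Set.Icc t₁ t₂ := ⟨le_rfl, ht.1.trans ht.2⟩
  have hw'mono : MonotoneOn w' (Set.Icc t₁ t₂) := by
    refine monotoneOn_Icc_of_hasDerivAt_nonneg hw' fun s hs => ?_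
    have h1 := hsmall s hs
    have h2 : 0 ≤ a ^ 2 - K * w s ^ δ := by nlinarith
    exact (mul_nonneg h2 (hpos s hs).le).trans (hode s hs)
  have hw'0 : ∀ s ∈ Set.Icc t₁ t₂, 0 ≤ w' s := fun s hs => h0.trans (hw'mono ht₁ hs hs.1)
  refine ⟨monotoneOn_Icc_of_hasDerivAt_nonneg hw hw'0 ht₁ ht ht.1, ?_⟩
  have hv0 : ∀ s ∈ Set.Icc t₁ t₂, 0 ≤ w' s / w s := fun s hs =>
    div_nonneg (hw'0 s hs) (hpos s hs).le
  have hGmono := monotoneOn_Icc_of_hasDerivAt_nonneg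
    (f := fun s => Real.log (w s) + -(2 * a) * (a + w' s / w s)⁻¹ +
      4 * K / (a ^ 2 * δ) * w s ^ δ - a * s)
    (f' := fun s => w' s / w s +
      -(2 * a) * (-((w'' s * w s - w' s * w' s) / w s ^ 2) / (a + w' s / w s) ^ 2) +
      4 * K / (a ^ 2 * δ) * (w' s * δ * w s ^ (δ - 1)) - a * 1) (t₁ := t₁) (t₂ := t₂)
    (fun s hs => by
      have hws := (hpos s hs).ne'
      have hne : a + w' s / w s ≠ 0 := (add_pos_of_pos_of_nonneg ha (hv0 s hs)).ne'
      exact ((((hw s hs).log hws).add (((((hw' s hs).div (hw s hs) hws).const_add a).inv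
        hne).const_mul _)).add (((hw s hs).rpow_const (Or.inl hws)).const_mul _)).sub
          ((hasDerivAt_id s).const_mul a))
    (fun s hs => by
      have hws := hpos s hs
      have hrp := Real.rpow_pos_of_pos hws δ
      have hode' : a ^ 2 - K * w s ^ δ - (w' s / w s) ^ 2 ≤
          (w'' s * w s - w' s * w' s) / w s ^ 2 := by
        have h1 : a ^ 2 - K * w s ^ δ ≤ w'' s / w s := (le_div_iff₀ hws).2 (hode s hs)
        have h2 : (w'' s * w s - w' s * w' s) / w s ^ 2 = w'' s / w s - (w' s / w s) ^ 2 := by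
          field_simp
        linarith
      have h := riccati_lyapunov_bound ha (hv0 s hs) (by positivity) (hsmall s hs) hode'
      rw [Real.rpow_sub_one hws.ne']
      have e1 : 4 * K / (a ^ 2 * δ) * (w' s * δ * (w s ^ δ / w s)) =
          4 / a ^ 2 * (w' s / w s * (K * w s ^ δ)) := by
        field_simp
      rw [e1]
      refine (sub_nonneg.2 h).trans_eq ?_
      ring)
  have hG := hGmono ht₁ ht ht.1
  simp only at hG
  have hlog : Real.log (w t / w t₁) = Real.log (w t) - Real.log (w t₁) :=
    Real.log_div (hpos t ht).ne' (hpos t₁ ht₁).ne'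
  have hi : 0 ≤ 2 * a * (a + w' t / w t)⁻¹ := by
    have := hv0 t ht
    positivity
  have hi₁ : 2 * a * (a + w' t₁ / w t₁)⁻¹ ≤ 2 := by
    have := hv0 t₁ ht₁
    rw [← div_eq_mul_inv, div_le_iff₀ (by linarith)]
    linarith
  have hp₁ : 0 ≤ 4 * K / (a ^ 2 * δ) * w t₁ ^ δ := by
    have := Real.rpow_pos_of_pos (hpos t₁ ht₁) δ
    positivity
  have hp : 4 * K / (a ^ 2 * δ) * w t ^ δ ≤ 1 / (2 * δ) := by
    have e1 : 4 * K / (a ^ 2 * δ) * w t ^ δ = 4 / (a ^ 2 * δ) * (K * w t ^ δ) := by ring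
    have e2 : 1 / (2 * δ) = 4 / (a ^ 2 * δ) * (a ^ 2 / 8) := by
      field_simp
      norm_num
    rw [e1, e2]
    exact mul_le_mul_of_nonneg_left (hsmall t ht) (by positivity)
  rw [le_div_iff₀ ha, hlog]
  linarith


/-- Lemma 6.3 (ii): for `n ≥ 3` and `b, c, τ > 0` there are positive
constants `t*, ε₀, C₁, C₂` depending only on `b, c, n, τ` such that any positive `C²`
function `w ≤ ε₀` on `[t₁,t₂]` (with `t* ≤ t₁ < t₂`) satisfying
`w'' - ((n-2)/2)²(1 - b e^{-τt}) w + (n(n-2)c/4) w^{(n+2)/(n-2)} ≥ 0` and `w'(t₁) ≥ 0`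
obeys `t - t₁ ≤ (2/(n-2) + C₁ e^{-τ t₁}) ln(w(t)/w(t₁)) + C₂` on `[t₁,t₂]`. -/
theorem nonlinear_ode_comparison_left (n : ℕ) (hn : 3 ≤ n) (b c τ : ℝ)
    (hb : 0 < b) (hc : 0 < c) (hτ : 0 < τ) :
    ∃ tstar ε₀ C₁ C₂ : ℝ, 0 < tstar ∧ 0 < ε₀ ∧ 0 < C₁ ∧ 0 < C₂ ∧
      ∀ t₁ t₂ : ℝ, tstar ≤ t₁ → t₁ < t₂ →
        ∀ w w' w'' : ℝ → ℝ,
          (∀ t ∈ Set.Icc t₁ t₂, 0 < w t) →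
          (∀ t ∈ Set.Icc t₁ t₂, HasDerivAt w (w' t) t) →
          (∀ t ∈ Set.Icc t₁ t₂, HasDerivAt w' (w'' t) t) →
          ContinuousOn w'' (Set.Icc t₁ t₂) →
          (∀ t ∈ Set.Icc t₁ t₂,
            0 ≤ w'' t - (((n : ℝ) - 2) / 2) ^ 2 * (1 - b * Real.exp (-τ * t)) * w t
                + (n : ℝ) * ((n : ℝ) - 2) * c / 4 *
                    w t ^ (((n : ℝ) + 2) / ((n : ℝ) - 2))) →
          (∀ t ∈ Set.Icc t₁ t₂, w t ≤ ε₀) →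
          0 ≤ w' t₁ →
          ∀ t ∈ Set.Icc t₁ t₂,
            t - t₁ ≤ (2 / ((n : ℝ) - 2) + C₁ * Real.exp (-τ * t₁)) *
                Real.log (w t / w t₁) + C₂ := by
  have hn' : (3 : ℝ) ≤ n := by exact_mod_cast hn
  obtain ⟨m, hm⟩ : ∃ m : ℝ, m = ((n : ℝ) - 2) / 2 := ⟨_, rfl⟩
  have hm0 : 0 < m := by linarith
  have hnm : (n : ℝ) = 2 * m + 2 := by linarith
  obtain ⟨K, hK⟩ : ∃ K : ℝ, K = (n : ℝ) * ((n : ℝ) - 2) * c / 4 := ⟨_, rfl⟩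
  have hK0 : 0 < K := by
    have : 0 < (n : ℝ) - 2 := by linarith
    rw [hK]
    positivity
  obtain ⟨δ, hδ⟩ : ∃ δ : ℝ, δ = 2 / m := ⟨_, rfl⟩
  have hδ0 : 0 < δ := by
    rw [hδ]
    positivity
  have hexp : ((n : ℝ) + 2) / ((n : ℝ) - 2) = δ + 1 := by
    rw [hδ, hnm, add_sub_cancel_right]
    field_simp
    ring
  have hslope : 2 / ((n : ℝ) - 2) = 1 / m := by
    rw [hm]
    field_simp
  rw [← hm, ← hK, hexp, hslope]
  refine ⟨max 1 (Real.log (2 * b) / τ), (m ^ 2 / (18 * K)) ^ (1 / δ), b / m,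
    (2 + 1 / (2 * δ)) * (3 / (2 * m)), by positivity, by positivity, by positivity,
    by positivity, ?_⟩
  intro t₁ t₂ hts ht12 w w' w'' hpos hw hw' _ hode hsmall h0 t ht
  obtain ⟨s, hs⟩ : ∃ s : ℝ, s = b * Real.exp (-τ * t₁) := ⟨_, rfl⟩
  have hs0 : 0 < s := by
    rw [hs]
    positivity
  have hs2 : s ≤ 1 / 2 := by
    have h1 : Real.log (2 * b) ≤ t₁ * τ :=
      (div_le_iff₀ hτ).1 ((le_max_right _ _).trans hts)
    have h2 : 2 * b ≤ Real.exp (t₁ * τ) := (Real.log_le_iff_le_exp (by positivity)).1 h1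
    have h3 : Real.exp (-τ * t₁) = (Real.exp (t₁ * τ))⁻¹ := by
      rw [← Real.exp_neg]
      ring_nf
    rw [hs, h3, ← div_eq_mul_inv, div_le_iff₀ (Real.exp_pos _)]
    linarith
  obtain ⟨a, ha⟩ : ∃ a : ℝ, a = m / (1 + s) := ⟨_, rfl⟩
  have ha0 : 0 < a := by
    rw [ha]
    positivity
  have ha_inv : 1 / a = 1 / m + b / m * Real.exp (-τ * t₁) := by
    have h : b / m * Real.exp (-τ * t₁) = s / m := by
      rw [hs]
      ring
    rw [h, ha]
    field_simp
  have ha_lower : 2 * m / 3 ≤ a := by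
    rw [ha, le_div_iff₀ (by linarith)]
    nlinarith
  have ha_upper : a ^ 2 ≤ m ^ 2 * (1 - s) := by
    rw [ha, div_pow, div_le_iff₀ (by positivity), mul_assoc]
    refine le_mul_of_one_le_right (sq_nonneg m) ?_
    nlinarith [mul_nonneg hs0.le (sub_nonneg.2 hs2), mul_pos hs0 hs0,
      mul_nonneg (mul_pos hs0 hs0).le (sub_nonneg.2 hs2)]
  have hsmall' : ∀ r ∈ Set.Icc t₁ t₂, K * w r ^ δ ≤ a ^ 2 / 8 := fun r hr => by
    have h1 : w r ^ δ ≤ m ^ 2 / (18 * K) := by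
      refine (Real.rpow_le_rpow (hpos r hr).le (hsmall r hr) hδ0.le).trans_eq ?_
      rw [← Real.rpow_mul (by positivity), one_div_mul_cancel hδ0.ne', Real.rpow_one]
    have h2 : K * w r ^ δ ≤ K * (m ^ 2 / (18 * K)) := by gcongr
    have h3 : K * (m ^ 2 / (18 * K)) = m ^ 2 / 18 := by field_simp
    nlinarith
  have hode' : ∀ r ∈ Set.Icc t₁ t₂, (a ^ 2 - K * w r ^ δ) * w r ≤ w'' r := fun r hr => by
    have h1 := hode r hr
    rw [Real.rpow_add_one (hpos r hr).ne'] at h1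
    have h2 : b * Real.exp (-τ * r) ≤ s := by
      rw [hs]
      refine mul_le_mul_of_nonneg_left (Real.exp_le_exp.2 ?_) hb.le
      nlinarith [hr.1]
    have h3 : a ^ 2 ≤ m ^ 2 * (1 - b * Real.exp (-τ * r)) :=
      ha_upper.trans (by gcongr)
    have h4 := mul_le_mul_of_nonneg_right h3 (hpos r hr).le
    linarith
  have hmain := (sub_le_log_div_of_fowler_inequality ha0 hK0 hδ0 hpos hw hw' hode' hsmall' h0
    ht).2
  have hC : (2 + 1 / (2 * δ)) * (1 / a) ≤ (2 + 1 / (2 * δ)) * (3 / (2 * m)) := by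
    refine mul_le_mul_of_nonneg_left ?_ (by positivity)
    rw [div_le_div_iff₀ ha0 (by positivity)]
    linarith
  rw [← ha_inv]
  refine hmain.trans (le_trans (le_of_eq ?_) (add_le_add_right hC _))
  ring
end

section
/- Let n ≥ 3 be an integer, b, c, τ > 0 and t₁ < t₂. Let w be a positive twice continuously differentiable function on [t₁,t₂] with w'(t) ≤ 0 on [t₁,t₂] satisfying w''(t) − ((n-2)/2)² (1 − b e^{-τt}) w(t) + (n(n−2)c/4) w(t)^{(n+2)/(n-2)} ≥ 0 for all t ∈ [t₁,t₂]. Then the function E(t) := w'(t)² − ((n-2)/2)² (1 − b e^{-τt}) w(t)² + c ((n-2)/2)² w(t)^{2n/(n-2)} is non-increasing on [t₁,t₂]. -/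
/-- energy monotonicity from Section 6: if `w > 0` is `C²` on
`[t₁,t₂]` with `w' ≤ 0` and
`w'' - ((n-2)/2)²(1 - b e^{-τt}) w + (n(n-2)c/4) w^{(n+2)/(n-2)} ≥ 0`, then
`E(t) = w'(t)² - ((n-2)/2)²(1 - b e^{-τt}) w(t)² + c((n-2)/2)² w(t)^{2n/(n-2)}` is
non-increasing on `[t₁,t₂]`. -/
theorem pohozaev_energy_monotone (n : ℕ) (hn : 3 ≤ n) (b c τ t₁ t₂ : ℝ)
    (hb : 0 < b) (hc : 0 < c) (hτ : 0 < τ) (h12 : t₁ < t₂)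
    (w w' w'' : ℝ → ℝ)
    (hpos : ∀ t ∈ Set.Icc t₁ t₂, 0 < w t)
    (hdec : ∀ t ∈ Set.Icc t₁ t₂, w' t ≤ 0)
    (hd1 : ∀ t ∈ Set.Icc t₁ t₂, HasDerivAt w (w' t) t)
    (hd2 : ∀ t ∈ Set.Icc t₁ t₂, HasDerivAt w' (w'' t) t)
    (hcont : ContinuousOn w'' (Set.Icc t₁ t₂))
    (hineq : ∀ t ∈ Set.Icc t₁ t₂,
      0 ≤ w'' t - (((n : ℝ) - 2) / 2) ^ 2 * (1 - b * Real.exp (-τ * t)) * w t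
          + (n : ℝ) * ((n : ℝ) - 2) * c / 4 * w t ^ (((n : ℝ) + 2) / ((n : ℝ) - 2))) :
    AntitoneOn
      (fun t => w' t ^ 2
        - (((n : ℝ) - 2) / 2) ^ 2 * (1 - b * Real.exp (-τ * t)) * w t ^ 2
        + c * (((n : ℝ) - 2) / 2) ^ 2 * w t ^ (2 * (n : ℝ) / ((n : ℝ) - 2)))
      (Set.Icc t₁ t₂) := by
  have hn' : (0 : ℝ) < (n : ℝ) - 2 := by
    have : (3 : ℝ) ≤ n := by exact_mod_cast hn
    linarith
  have hexp : 2 * (n : ℝ) / ((n : ℝ) - 2) - 1 = ((n : ℝ) + 2) / ((n : ℝ) - 2) := by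
    field_simp
    ring
  have hcoef : c * (((n : ℝ) - 2) / 2) ^ 2 * (2 * (n : ℝ) / ((n : ℝ) - 2))
      = 2 * ((n : ℝ) * ((n : ℝ) - 2) * c / 4) := by
    field_simp
    ring
  have hderiv : ∀ t ∈ Set.Icc t₁ t₂, HasDerivAt
      (fun t => w' t ^ 2
        - (((n : ℝ) - 2) / 2) ^ 2 * (1 - b * Real.exp (-τ * t)) * w t ^ 2
        + c * (((n : ℝ) - 2) / 2) ^ 2 * w t ^ (2 * (n : ℝ) / ((n : ℝ) - 2)))
      (2 * w' t * (w'' t - (((n : ℝ) - 2) / 2) ^ 2 * (1 - b * Real.exp (-τ * t)) * w t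
          + (n : ℝ) * ((n : ℝ) - 2) * c / 4 * w t ^ (((n : ℝ) + 2) / ((n : ℝ) - 2)))
        - (((n : ℝ) - 2) / 2) ^ 2 * (b * τ * Real.exp (-τ * t)) * w t ^ 2) t := by
    intro t ht
    have hpot : HasDerivAt (fun t => (((n : ℝ) - 2) / 2) ^ 2 * (1 - b * Real.exp (-τ * t)))
        ((((n : ℝ) - 2) / 2) ^ 2 * (b * τ * Real.exp (-τ * t))) t := by
      have h := (((((hasDerivAt_id t).const_mul (-τ)).exp).const_mul b).const_sub 1).const_mul
        ((((n : ℝ) - 2) / 2) ^ 2)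
      refine h.congr_deriv ?_
      simp only [id]
      ring
    have hpow := ((hd1 t ht).rpow_const (p := 2 * (n : ℝ) / ((n : ℝ) - 2))
      (Or.inl (hpos t ht).ne')).const_mul (c * (((n : ℝ) - 2) / 2) ^ 2)
    refine ((((hd2 t ht).pow 2).sub (hpot.mul ((hd1 t ht).pow 2))).add hpow).congr_deriv ?_
    rw [hexp]
    simp only [Pi.pow_apply, Nat.cast_ofNat, Nat.add_one_sub_one, pow_one]
    linear_combination (w' t * w t ^ (((n : ℝ) + 2) / ((n : ℝ) - 2))) * hcoef
  refine antitoneOn_of_deriv_nonpos (convex_Icc t₁ t₂)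
    (fun t ht => (hderiv t ht).continuousAt.continuousWithinAt)
    (fun t ht => (hderiv t (interior_subset ht)).differentiableAt.differentiableWithinAt) ?_
  intro t ht
  have ht' := interior_subset ht
  rw [(hderiv t ht').deriv]
  have hmain := mul_nonpos_of_nonpos_of_nonneg
    (by linarith [hdec t ht'] : 2 * w' t ≤ 0) (hineq t ht')
  have hextra : 0 ≤ (((n : ℝ) - 2) / 2) ^ 2 * (b * τ * Real.exp (-τ * t)) * w t ^ 2 := by
    positivity
  linarith
end

section
/- Let a > 0, T ∈ ℝ, and let w : [T,∞) → ℝ be a positive twice continuously differentiable function satisfying w''(t) − a² w(t) ≥ 0 for all t ≥ T and w(t) → 0 as t → ∞. Then w(t) ≤ w(T) e^{-a(t−T)} for all t ≥ T. -/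
/-- Grönwall-type lower bound: if `f' ≥ k f` on `[s, ∞)`, then `f` dominates the exponential
with rate `k` through `f s`. -/
theorem mul_exp_le_of_mul_le_deriv {f f' : ℝ → ℝ} {k s t : ℝ}
    (hf : ∀ x, s ≤ x → HasDerivAt f (f' x) x) (hle : ∀ x, s ≤ x → k * f x ≤ f' x)
    (hst : s ≤ t) : f s * Real.exp (k * (t - s)) ≤ f t := by
  have hd : ∀ x, s ≤ x → HasDerivAt (fun x => f x * Real.exp (-k * (x - s)))
      ((f' x - k * f x) * Real.exp (-k * (x - s))) x := fun x hx => by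
    refine ((hf x hx).mul ((((hasDerivAt_id' x).sub_const s).const_mul (-k)).exp)).congr_deriv ?_
    ring
  have hmono : MonotoneOn (fun x => f x * Real.exp (-k * (x - s))) (Set.Ici s) := by
    refine monotoneOn_of_hasDerivWithinAt_nonneg (convex_Ici s)
      (fun x hx => (hd x hx).continuousAt.continuousWithinAt)
      (fun x hx => (hd x (interior_subset hx)).hasDerivWithinAt) fun x hx => ?_
    exact mul_nonneg (sub_nonneg.2 (hle x (interior_subset hx))) (Real.exp_pos _).le
  have h := hmono Set.self_mem_Ici hst hst
  simp only [sub_self, mul_zero, Real.exp_zero, mul_one] at h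
  calc f s * Real.exp (k * (t - s))
      ≤ f t * Real.exp (-k * (t - s)) * Real.exp (k * (t - s)) := by gcongr
    _ = f t := by rw [mul_assoc, ← Real.exp_add]; simp

/-- A function tending to `0` at infinity cannot satisfy `w' + a w ≥ c > 0` on a half-line. -/
theorem not_forall_le_deriv_add_mul {a c s : ℝ} (ha : 0 < a) (hc : 0 < c) {w w' : ℝ → ℝ}
    (hw : ∀ x, s ≤ x → HasDerivAt w (w' x) x)
    (hlim : Filter.Tendsto w Filter.atTop (nhds 0)) :
    ¬ ∀ x, s ≤ x → c ≤ w' x + a * w x := by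
  intro h
  have hsmall : ∀ᶠ x in Filter.atTop, |w x| < c / (4 * a) := by
    have := hlim.abs
    rw [abs_zero] at this
    exact this.eventually_lt_const (by positivity)
  obtain ⟨r, hr⟩ := Filter.eventually_atTop.1 (hsmall.and (Filter.eventually_ge_atTop s))
  have hrs : s ≤ r := (hr r le_rfl).2
  have hbound : ∀ x, r ≤ x → a * |w x| < c / 4 := fun x hx => by
    have := mul_lt_mul_of_pos_left (hr x hx).1 ha
    rwa [show a * (c / (4 * a)) = c / 4 by field_simp] at this
  have hr' : r ≤ r + 1 / a := by simp [ha.le]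
  have hgrow := mul_exp_le_of_mul_le_deriv (k := 0) (s := r)
    (f := fun x => w x - 3 * c / 4 * x) (f' := fun x => w' x - 3 * c / 4)
    (fun x hx =>
      ((hw x (hrs.trans hx)).sub
        ((hasDerivAt_id' x).const_mul (3 * c / 4))).congr_deriv (by ring))
    (fun x hx => by
      linarith [h x (hrs.trans hx), hbound x hx,
        mul_le_mul_of_nonneg_left (le_abs_self (w x)) ha.le])
    hr'
  simp only [zero_mul, Real.exp_zero, mul_one] at hgrow
  have hstep : 3 * c / 4 * (1 / a) = 3 * (c / (4 * a)) := by field_simp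
  have h1 := neg_abs_le (w r)
  have h2 := le_abs_self (w (r + 1 / a))
  have hq : 0 < c / (4 * a) := by positivity
  linarith [(hr r le_rfl).1, (hr _ hr').1]

/-- exponential decay, end of proof of Proposition 5.3: if `w > 0`
is `C²` on `[T,∞)` with `w'' - a² w ≥ 0` and `w(t) → 0` as `t → ∞`, then
`w(t) ≤ w(T) e^{-a(t-T)}` for all `t ≥ T`. -/
theorem exponential_decay_from_convexity (a T : ℝ) (ha : 0 < a)
    (w w' w'' : ℝ → ℝ)
    (hpos : ∀ t, T ≤ t → 0 < w t)
    (hd1 : ∀ t, T ≤ t → HasDerivAt w (w' t) t)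
    (hd2 : ∀ t, T ≤ t → HasDerivAt w' (w'' t) t)
    (hcont : ContinuousOn w'' (Set.Ici T))
    (hineq : ∀ t, T ≤ t → 0 ≤ w'' t - a ^ 2 * w t)
    (hlim : Filter.Tendsto w Filter.atTop (nhds 0)) :
    ∀ t, T ≤ t → w t ≤ w T * Real.exp (-a * (t - T)) := by
  have hv : ∀ s, T ≤ s → w' s + a * w s ≤ 0 := by
    intro s hs
    by_contra! hpos_s
    refine not_forall_le_deriv_add_mul ha hpos_s (fun x hx => hd1 x (hs.trans hx)) hlim
      fun x hx => ?_
    have hexp := mul_exp_le_of_mul_le_deriv (k := a) (f := fun x => w' x + a * w x)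
      (f' := fun x => w'' x + a * w' x)
      (fun y hy => (hd2 y (hs.trans hy)).add ((hd1 y (hs.trans hy)).const_mul a))
      (fun y hy => by linarith [hineq y (hs.trans hy)]) hx
    refine le_trans ?_ hexp
    exact le_mul_of_one_le_right hpos_s.le
      (Real.one_le_exp (mul_nonneg ha.le (sub_nonneg.2 hx)))
  intro t ht
  have hdecay := mul_exp_le_of_mul_le_deriv (k := -a) (f := fun x => -w x)
    (f' := fun x => -w' x) (fun x hx => (hd1 x hx).neg)
    (fun x hx => by linarith [hv x hx]) ht
  linarith
end

section
/- Let n ≥ 3 be an integer, τ > 0 and C₀ > 0. Let g be a smooth map from {x ∈ ℝⁿ : |x| > 1} to the n×n real matrices such that |∇^m (g_{ij} − δ_{ij})(x)| ≤ C₀ |x|^{-τ-m} for all i,j, all |x| > 1, and all m = 0, 1, …, n+2. Define, for z ∈ B₁ \ {0}, the matrix ĝ(z) with entries ĝ_{kl}(z) = Σ_{i,j=1}^n (δ_{ik} − 2 z_i z_k/|z|²) g_{ij}(z/|z|²) (δ_{jl} − 2 z_j z_l/|z|²). Then there is a constant C > 0 depending only on n, τ and C₀ such that |∇^m (ĝ_{kl}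 − δ_{kl})(z)| ≤ C |z|^{τ-m} for all k,l, all z ∈ B₁ \ {0}, and all m = 0, 1, …, n+2. -/
open Metric

section
variable {E F : Type*} [NormedAddCommGroup E] [NormedSpace ℝ E]
  [NormedAddCommGroup F] [NormedSpace ℝ F]

theorem norm_iteratedFDerivWithin_comp_const_smul {s : Set E} (hs : UniqueDiffOn ℝ s)
    (f : E → F) {c : ℝ} (hc : c ≠ 0) {x : E} (hx : c • x ∈ s) (m : ℕ) :
    ‖iteratedFDerivWithin ℝ m (fun y => f (c • y)) ((fun y => c • y) ⁻¹' s) x‖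
      = |c| ^ m * ‖iteratedFDerivWithin ℝ m f s (c • x)‖ := by
  have h := (ContinuousLinearEquiv.smulLeft (R₁ := ℝ) (M₁ := E)
    (Units.mk0 c hc)).iteratedFDerivWithin_comp_right f hs (x := x) hx m
  have h' : iteratedFDerivWithin ℝ m (fun y => f (c • y)) ((fun y => c • y) ⁻¹' s) x
      = c ^ m • iteratedFDerivWithin ℝ m f s (c • x) := by
    refine Eq.trans h ?_
    ext v
    simpa using
      (iteratedFDerivWithin ℝ m f s (c • x)).map_smul_univ (fun _ => c) v
  rw [h', norm_smul, norm_pow, Real.norm_eq_abs]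

theorem norm_iteratedFDerivWithin_mul_le_two_pow {s : Set E} (hs : UniqueDiffOn ℝ s)
    {f g : E → ℝ} {N : ℕ} (hf : ContDiffOn ℝ N f s) (hg : ContDiffOn ℝ N g s)
    {x : E} (hx : x ∈ s) {a b : ℝ}
    (ha : ∀ i ≤ N, ‖iteratedFDerivWithin ℝ i f s x‖ ≤ a)
    (hb : ∀ i ≤ N, ‖iteratedFDerivWithin ℝ i g s x‖ ≤ b) :
    ∀ i ≤ N, ‖iteratedFDerivWithin ℝ i (fun y => f y * g y) s x‖ ≤ 2 ^ N * (a * b) := by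
  intro m hm
  have ha0 : 0 ≤ a := (norm_nonneg _).trans (ha m hm)
  have hb0 : 0 ≤ b := (norm_nonneg _).trans (hb m hm)
  refine (norm_iteratedFDerivWithin_mul_le hf hg hs hx (by exact_mod_cast hm)).trans ?_
  calc _ ≤ ∑ i ∈ Finset.range (m + 1), (m.choose i : ℝ) * a * b := by
        gcongr with i hi
        · exact ha i (by have := Finset.mem_range.1 hi; omega)
        · exact hb _ (by omega)
    _ = 2 ^ m * (a * b) := by
        simp_rw [mul_assoc, ← Finset.sum_mul]
        rw [← Nat.cast_sum, Nat.sum_range_choose]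
        push_cast; rfl
    _ ≤ _ := by gcongr; norm_num

theorem exists_norm_iteratedFDerivWithin_le_on_sphere [FiniteDimensional ℝ E] {f : E → F}
    (hf : ContDiffOn ℝ (⊤ : ℕ∞) f {0}ᶜ) (N : ℕ) :
    ∃ K : ℝ, 1 ≤ K ∧ ∀ s : Set E, IsOpen s → ∀ w ∈ s, ‖w‖ = 1 → ∀ i ≤ N,
      ‖iteratedFDerivWithin ℝ i f s w‖ ≤ K := by
  have key : ∀ i : ℕ, ∃ K : ℝ, ∀ w ∈ sphere (0 : E) 1, ‖iteratedFDeriv ℝ i f w‖ ≤ K := by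
    intro i
    refine (isCompact_sphere (0 : E) 1).exists_bound_of_continuousOn fun w hw => ?_
    have hw0 : w ≠ 0 := ne_zero_of_mem_unit_sphere ⟨w, hw⟩
    exact (((hf.contDiffAt (isOpen_compl_singleton.mem_nhds hw0)).continuousAt_iteratedFDeriv
      (by exact_mod_cast le_top))).continuousWithinAt
  choose K hK using key
  refine ⟨1 + ∑ i ∈ Finset.range (N + 1), |K i|, ?_, fun s hs w hw hw1 i hi => ?_⟩
  · have : 0 ≤ ∑ i ∈ Finset.range (N + 1), |K i| := Finset.sum_nonneg fun _ _ => abs_nonneg _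
    linarith
  · rw [iteratedFDerivWithin_of_isOpen i hs hw]
    have h1 := Finset.single_le_sum (f := fun i => |K i|) (fun _ _ => abs_nonneg _)
      (Finset.mem_range.2 (Nat.lt_succ_of_le hi))
    have h2 := hK i w (by simpa using hw1)
    have h3 := le_abs_self (K i)
    linarith
end

theorem contDiffOn_inversion {E : Type*} [NormedAddCommGroup E] [InnerProductSpace ℝ E] :
    ContDiffOn ℝ (⊤ : ℕ∞) (fun w : E => (‖w‖ ^ 2)⁻¹ • w) {0}ᶜ := by
  refine ContDiffOn.smul (ContDiffOn.inv (contDiff_norm_sq ℝ).contDiffOn fun w hw => ?_)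
    contDiffOn_id
  have : w ≠ 0 := hw
  positivity

/-- The entries of the reflection `1 - 2 w wᵀ / |w|²`. -/
noncomputable def reflectionEntry {n : ℕ} (i k : Fin n) (w : EuclideanSpace ℝ (Fin n)) : ℝ :=
  (if i = k then (1 : ℝ) else 0) - 2 * w i * w k / ‖w‖ ^ 2

theorem contDiffOn_reflectionEntry {n : ℕ} (i k : Fin n) :
    ContDiffOn ℝ (⊤ : ℕ∞) (reflectionEntry i k) {0}ᶜ := by
  have hc : ∀ j : Fin n, ContDiff ℝ (⊤ : ℕ∞) fun w : EuclideanSpace ℝ (Fin n) => w j :=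
    fun j => by fun_prop
  refine contDiffOn_const.sub (ContDiffOn.div
    ((contDiff_const.mul (hc i)).mul (hc k)).contDiffOn (contDiff_norm_sq ℝ).contDiffOn
    fun w hw => ?_)
  have : w ≠ 0 := hw
  positivity

theorem reflectionEntry_smul {n : ℕ} (i k : Fin n) {r : ℝ} (hr : r ≠ 0)
    (w : EuclideanSpace ℝ (Fin n)) : reflectionEntry i k (r • w) = reflectionEntry i k w := by
  simp only [reflectionEntry, PiLp.smul_apply, smul_eq_mul, norm_smul, mul_pow,
    Real.norm_eq_abs, sq_abs]
  congr 1
  rw [show 2 * (r * w i) * (r * w k) = r ^ 2 * (2 * w i * w k) by ring,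
    mul_div_mul_left _ _ (pow_ne_zero 2 hr)]

theorem sum_reflectionEntry_mul {n : ℕ} (k l : Fin n) {w : EuclideanSpace ℝ (Fin n)}
    (hw : w ≠ 0) :
    ∑ i, reflectionEntry i k w * reflectionEntry i l w = if k = l then (1 : ℝ) else 0 := by
  have h1 : ‖w‖ ^ 2 ≠ 0 := by positivity
  have h2 : ∑ i, w i * w i = ‖w‖ ^ 2 := by
    rw [EuclideanSpace.real_norm_sq_eq]; simp [sq]
  have h3 : ∀ i, reflectionEntry i k w * reflectionEntry i l w
      = (if i = k then (if i = l then (1 : ℝ) else 0) else 0)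
        - (if i = k then 2 * w i * w l / ‖w‖ ^ 2 else 0)
        - (if i = l then 2 * w i * w k / ‖w‖ ^ 2 else 0)
        + (w i * w i) * (4 * w k * w l / (‖w‖ ^ 2) ^ 2) := by
    intro i
    simp only [reflectionEntry]
    split_ifs <;> field_simp <;> ring
  simp_rw [h3]
  rw [Finset.sum_add_distrib, Finset.sum_sub_distrib, Finset.sum_sub_distrib, ← Finset.sum_mul, h2]
  simp only [Finset.sum_ite_eq', Finset.mem_univ, if_true]
  field_simp
  ring

theorem norm_inversion {E : Type*} [NormedAddCommGroup E] [NormedSpace ℝ E] {w : E}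
    (hw : w ≠ 0) : ‖(‖w‖ ^ 2)⁻¹ • w‖ = ‖w‖⁻¹ := by
  have : ‖w‖ ≠ 0 := by positivity
  rw [norm_smul, norm_inv, norm_pow, norm_norm]
  field_simp

/-- After rescaling to the unit sphere, a function with decay rate `τ` near infinity composed
with the inversion has derivatives of size `r ^ τ`. -/
theorem norm_iteratedFDerivWithin_comp_inversion_le {E : Type*} [NormedAddCommGroup E]
    [InnerProductSpace ℝ E] {h : E → ℝ} {N : ℕ} {τ C₀ D r : ℝ} (hC₀ : 0 ≤ C₀) (hD : 1 ≤ D)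
    (hr : 0 < r)
    (hh : ContDiffOn ℝ N h {x | 1 < ‖x‖})
    (hb : ∀ m ≤ N, ∀ x : E, 1 < ‖x‖ →
      ‖iteratedFDerivWithin ℝ m h {y | 1 < ‖y‖} x‖ ≤ C₀ * ‖x‖ ^ (-τ - (m : ℝ)))
    {s : Set E} (hs : IsOpen s) (hs' : ∀ w ∈ s, w ≠ 0 ∧ ‖w‖ < r⁻¹)
    {w : E} (hw : w ∈ s) (hw1 : ‖w‖ = 1)
    (hI : ∀ i ≤ N, ‖iteratedFDerivWithin ℝ i (fun w : E => (‖w‖ ^ 2)⁻¹ • w) s w‖ ≤ D) :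
    ContDiffOn ℝ N (fun y => h (r⁻¹ • ((‖y‖ ^ 2)⁻¹ • y))) s ∧
    ∀ m ≤ N, ‖iteratedFDerivWithin ℝ m (fun y => h (r⁻¹ • ((‖y‖ ^ 2)⁻¹ • y))) s w‖
      ≤ N.factorial * (C₀ * r ^ τ) * D ^ N := by
  have hV : IsOpen {x : E | 1 < ‖x‖} := isOpen_lt continuous_const continuous_norm
  have hT : IsOpen ((fun y : E => r⁻¹ • y) ⁻¹' {x : E | 1 < ‖x‖}) :=
    hV.preimage (continuous_const_smul _)
  have hmaps : Set.MapsTo (fun w : E => (‖w‖ ^ 2)⁻¹ • w) s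
      ((fun y : E => r⁻¹ • y) ⁻¹' {x : E | 1 < ‖x‖}) := by
    intro y hy
    obtain ⟨hy0, hy1⟩ := hs' y hy
    have hy2 : 0 < ‖y‖ := norm_pos_iff.2 hy0
    change 1 < ‖r⁻¹ • ((‖y‖ ^ 2)⁻¹ • y)‖
    rw [norm_smul, norm_inversion hy0, Real.norm_of_nonneg (by positivity),
      ← div_eq_mul_inv, one_lt_div hy2]
    exact hy1
  have hhr : ContDiffOn ℝ N (fun y => h (r⁻¹ • y))
      ((fun y : E => r⁻¹ • y) ⁻¹' {x : E | 1 < ‖x‖}) :=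
    hh.comp (contDiff_const_smul _).contDiffOn fun _ hx => hx
  have hinv : ContDiffOn ℝ N (fun w : E => (‖w‖ ^ 2)⁻¹ • w) s :=
    (contDiffOn_inversion.of_le (by exact_mod_cast le_top)).mono fun y hy => (hs' y hy).1
  refine ⟨hhr.comp hinv hmaps, fun m hm => ?_⟩
  have hfw : (‖w‖ ^ 2)⁻¹ • w = w := by simp [hw1]
  have hmem : r⁻¹ • w ∈ {x : E | 1 < ‖x‖} := by simpa [hfw] using hmaps hw
  have hnorm : ‖r⁻¹ • w‖ = r⁻¹ := by
    rw [norm_smul, hw1, mul_one, Real.norm_of_nonneg (by positivity)]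
  refine (norm_iteratedFDerivWithin_comp_le (N := N) (C := C₀ * r ^ τ) (D := D) hhr hinv
    (by exact_mod_cast hm) hT.uniqueDiffOn hs.uniqueDiffOn hmaps hw ?_ ?_).trans ?_
  · intro i hi
    rw [hfw, norm_iteratedFDerivWithin_comp_const_smul hV.uniqueDiffOn h (by positivity) hmem]
    refine (mul_le_mul_of_nonneg_left (hb i (hi.trans hm) _ hmem) (by positivity)).trans_eq ?_
    rw [hnorm, abs_of_pos (by positivity), Real.inv_rpow hr.le, ← Real.rpow_neg hr.le,
      show -(-τ - (i : ℝ)) = τ + i by ring, Real.rpow_add hr, Real.rpow_natCast]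
    rw [inv_pow]
    field_simp
  · intro i hi1 hi
    exact (hI i (hi.trans hm)).trans (le_self_pow₀ hD (by omega))
  · have : 0 ≤ C₀ * r ^ τ := by positivity
    gcongr

/-- Section 2 of the paper: if the matrix-valued map `g` on
`{|x| > 1}` satisfies the asymptotic flatness bounds
`|∇^m (g_{ij} - δ_{ij})(x)| ≤ C₀ |x|^{-τ-m}` for `m = 0, …, n+2`, then its pullback
`ĝ_{kl}(z) = Σ_{i,j} (δ_{ik} - 2 z_i z_k/|z|²) g_{ij}(z/|z|²) (δ_{jl} - 2 z_j z_l/|z|²)`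
under the inversion `x = z/|z|²` satisfies
`|∇^m (ĝ_{kl} - δ_{kl})(z)| ≤ C |z|^{τ-m}` on `B₁ \ {0}` for `m = 0, …, n+2`, with `C`
depending only on `n`, `τ` and `C₀`. -/
theorem inversion_pullback_flatness (n : ℕ) (hn : 3 ≤ n) (τ C₀ : ℝ)
    (hτ : 0 < τ) (hC₀ : 0 < C₀) :
    ∃ C : ℝ, 0 < C ∧
      ∀ g : EuclideanSpace ℝ (Fin n) → Fin n → Fin n → ℝ,
        (∀ i j, ContDiffOn ℝ (⊤ : ℕ∞) (fun x => g x i j)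
          {x : EuclideanSpace ℝ (Fin n) | 1 < ‖x‖}) →
        (∀ i j, ∀ m ≤ n + 2, ∀ x : EuclideanSpace ℝ (Fin n), 1 < ‖x‖ →
          ‖iteratedFDerivWithin ℝ m
              (fun y => g y i j - if i = j then (1 : ℝ) else 0)
              {y : EuclideanSpace ℝ (Fin n) | 1 < ‖y‖} x‖
            ≤ C₀ * ‖x‖ ^ (-τ - (m : ℝ))) →
        ∀ k l, ∀ m ≤ n + 2, ∀ z : EuclideanSpace ℝ (Fin n),
          z ∈ ball (0 : EuclideanSpace ℝ (Fin n)) 1 \ {0} →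
          ‖iteratedFDerivWithin ℝ m
              (fun w => (∑ i, ∑ j,
                  ((if i = k then (1 : ℝ) else 0) - 2 * w i * w k / ‖w‖ ^ 2) *
                    g ((‖w‖ ^ 2)⁻¹ • w) i j *
                  ((if j = l then (1 : ℝ) else 0) - 2 * w j * w l / ‖w‖ ^ 2))
                - if k = l then (1 : ℝ) else 0)
              (ball (0 : EuclideanSpace ℝ (Fin n)) 1 \ {0}) z‖
            ≤ C * ‖z‖ ^ (τ - (m : ℝ)) := by
  obtain ⟨D, hD1, hD⟩ := exists_norm_iteratedFDerivWithin_le_on_sphere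
    (contDiffOn_inversion (E := EuclideanSpace ℝ (Fin n))) (n + 2)
  have hA := fun i k : Fin n => exists_norm_iteratedFDerivWithin_le_on_sphere
    (contDiffOn_reflectionEntry i k) (n + 2)
  choose K hK1 hK using hA
  obtain ⟨c, hcdef⟩ : ∃ c : Fin n → Fin n → Fin n → Fin n → ℝ, ∀ k l i j, c k l i j =
      2 ^ (n + 2) * (2 ^ (n + 2) * (K i k * ((n + 2).factorial * C₀ * D ^ (n + 2))) * K j l) :=
    ⟨_, fun _ _ _ _ => rfl⟩
  have hc : ∀ k l i j, 0 ≤ c k l i j := fun k l i j => by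
    have h1 : 0 ≤ K i k := zero_le_one.trans (hK1 i k)
    have h2 : 0 ≤ K j l := zero_le_one.trans (hK1 j l)
    have h3 : 0 ≤ D := zero_le_one.trans hD1
    rw [hcdef]
    positivity
  have hcs : ∀ k l, 0 ≤ ∑ i, ∑ j, c k l i j := fun k l =>
    Finset.sum_nonneg fun i _ => Finset.sum_nonneg fun j _ => hc k l i j
  have hcs' : 0 ≤ ∑ k, ∑ l, ∑ i, ∑ j, c k l i j :=
    Finset.sum_nonneg fun k _ => Finset.sum_nonneg fun l _ => hcs k l
  refine ⟨1 + ∑ k, ∑ l, ∑ i, ∑ j, c k l i j, by positivity, ?_⟩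
  intro g hg hgb k l m hm z hz
  have hcle : ∑ i, ∑ j, c k l i j ≤ 1 + ∑ k, ∑ l, ∑ i, ∑ j, c k l i j := by
    have h1 := Finset.single_le_sum (f := fun l => ∑ i, ∑ j, c k l i j)
      (fun l _ => hcs k l) (Finset.mem_univ l)
    have h2 := Finset.single_le_sum (f := fun k => ∑ l, ∑ i, ∑ j, c k l i j)
      (fun k _ => Finset.sum_nonneg fun l _ => hcs k l) (Finset.mem_univ k)
    linarith
  have hz0 : z ≠ 0 := hz.2
  set r := ‖z‖ with hrdef
  have hr : 0 < r := norm_pos_iff.2 hz0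
  set U : Set (EuclideanSpace ℝ (Fin n)) := ball 0 1 \ {0} with hU
  have hUo : IsOpen U := isOpen_ball.sdiff isClosed_singleton
  set s : Set (EuclideanSpace ℝ (Fin n)) := (fun y => r • y) ⁻¹' U with hs
  have hso : IsOpen s := hUo.preimage (continuous_const_smul _)
  have hs' : ∀ w ∈ s, w ≠ 0 ∧ ‖w‖ < r⁻¹ := by
    intro w hw
    have h1 : r • w ∈ U := hw
    rw [hU, Set.mem_sdiff, mem_ball_zero_iff, norm_smul, Real.norm_of_nonneg hr.le] at h1
    refine ⟨fun h => h1.2 (by simp [h]), ?_⟩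
    rw [← one_div, lt_div_iff₀ hr, mul_comm]
    exact h1.1
  set w := r⁻¹ • z with hwdef
  have hrw : r • w = z := by rw [hwdef, smul_inv_smul₀ hr.ne']
  have hws : w ∈ s := by simpa [hs, hrw] using hz
  have hw1 : ‖w‖ = 1 := by
    rw [hwdef, norm_smul, norm_inv, norm_norm]
    exact inv_mul_cancel₀ hr.ne'
  let h : Fin n → Fin n → EuclideanSpace ℝ (Fin n) → ℝ :=
    fun i j y => g y i j - if i = j then (1 : ℝ) else 0
  set f : EuclideanSpace ℝ (Fin n) → ℝ := fun w => (∑ i, ∑ j,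
                  ((if i = k then (1 : ℝ) else 0) - 2 * w i * w k / ‖w‖ ^ 2) *
                    g ((‖w‖ ^ 2)⁻¹ • w) i j *
                  ((if j = l then (1 : ℝ) else 0) - 2 * w j * w l / ‖w‖ ^ 2))
                - if k = l then (1 : ℝ) else 0 with hf
  have hF : Set.EqOn (fun y => f (r • y)) (fun y => ∑ i, ∑ j, reflectionEntry i k y *
      h i j (r⁻¹ • ((‖y‖ ^ 2)⁻¹ • y)) * reflectionEntry j l y) s := by
    intro y hy
    have hy0 := (hs' y hy).1
    have hx : (‖r • y‖ ^ 2)⁻¹ • (r • y) = r⁻¹ • ((‖y‖ ^ 2)⁻¹ • y) := by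
      rw [norm_smul, Real.norm_of_nonneg hr.le, smul_smul, smul_smul]
      congr 1
      field_simp
    change (∑ i, ∑ j, reflectionEntry i k (r • y) * g ((‖r • y‖ ^ 2)⁻¹ • (r • y)) i j *
      reflectionEntry j l (r • y)) - (if k = l then (1 : ℝ) else 0) = _
    simp only [hx, reflectionEntry_smul _ _ hr.ne', ← sum_reflectionEntry_mul k l hy0, h,
      mul_sub, sub_mul, Finset.sum_sub_distrib]
    simp
  have htop : ((n + 2 : ℕ) : WithTop ℕ∞) ≤ ((⊤ : ℕ∞) : WithTop ℕ∞) := by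
    generalize n + 2 = N
    exact_mod_cast le_top
  have hterm : ∀ i j, ContDiffOn ℝ (n + 2 : ℕ) (fun y => reflectionEntry i k y *
        h i j (r⁻¹ • ((‖y‖ ^ 2)⁻¹ • y)) * reflectionEntry j l y) s ∧
      ∀ p ≤ n + 2, ‖iteratedFDerivWithin ℝ p (fun y => reflectionEntry i k y *
        h i j (r⁻¹ • ((‖y‖ ^ 2)⁻¹ • y)) * reflectionEntry j l y) s w‖ ≤ c k l i j * r ^ τ := by
    intro i j
    have hR : ∀ i k : Fin n, ContDiffOn ℝ (n + 2 : ℕ) (reflectionEntry i k) s := fun i k =>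
      ((contDiffOn_reflectionEntry i k).of_le htop).mono
        fun y hy => (hs' y hy).1
    obtain ⟨h1, h2⟩ := norm_iteratedFDerivWithin_comp_inversion_le (N := n + 2) hC₀.le hD1 hr
      (h := h i j) (((hg i j).sub contDiffOn_const).of_le htop)
      (hgb i j) hso hs' hws hw1 (hD s hso w hws hw1)
    have h3 := norm_iteratedFDerivWithin_mul_le_two_pow hso.uniqueDiffOn (hR i k) h1 hws
      (hK i k s hso w hws hw1) h2
    have h4 := norm_iteratedFDerivWithin_mul_le_two_pow hso.uniqueDiffOn ((hR i k).mul h1)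
      (hR j l) hws h3 (hK j l s hso w hws hw1)
    refine ⟨((hR i k).mul h1).mul (hR j l), fun p hp => (h4 p hp).trans_eq ?_⟩
    rw [hcdef]
    ring
  have hm' : (m : WithTop ℕ∞) ≤ ((n + 2 : ℕ) : WithTop ℕ∞) := by exact_mod_cast hm
  have hbound : ‖iteratedFDerivWithin ℝ m (fun y => f (r • y)) s w‖
      ≤ (∑ i, ∑ j, c k l i j) * r ^ τ := by
    rw [iteratedFDerivWithin_congr hF hws,
      iteratedFDerivWithin_fun_sum_apply hso.uniqueDiffOn hws fun i _ =>
        ContDiffWithinAt.sum fun j _ => ((hterm i j).1 w hws).of_le hm', Finset.sum_mul]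
    refine norm_sum_le_of_le _ fun i _ => ?_
    rw [iteratedFDerivWithin_fun_sum_apply hso.uniqueDiffOn hws fun j _ =>
      ((hterm i j).1 w hws).of_le hm', Finset.sum_mul]
    exact norm_sum_le_of_le _ fun j _ => (hterm i j).2 m hm
  rw [norm_iteratedFDerivWithin_comp_const_smul hUo.uniqueDiffOn f hr.ne' (hrw ▸ hz), hrw,
    abs_of_pos hr] at hbound
  rw [Real.rpow_sub hr, Real.rpow_natCast, ← mul_div_assoc, le_div_iff₀ (by positivity), mul_comm]
  exact hbound.trans (by gcongr)
end
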